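/- arXiv:2201.05113 — 8 statements merged into one kernel-verified Lean document; each statement's English description precedes it below -/
import Mathlib

section
/- For every integer k ≥ 2 and m = k machines, every deterministic online algorithm for cardinality constrained scheduling on m machines with cardinality bound k admits an input sequence with at most m·k jobs on which the induced schedule is either infeasible or has makespan at least (2 − 1/k)·OPT; in particular no such algorithm is α-competitive for any α < 2 − 1/k. -/
open Finset

/-- The load of machine `i` under schedule `σ` for job sizes `p`. -/
noncomputable def machineLoad {n m : ℕ} (p : Fin n → ℝ) (σ : Fin n → Fin m) (i : Fin m) : ℝ :=
  ∑ j ∈ Finset.univ.filter (fun j => σ j = i), p j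

/-- The makespan of a schedule: the maximum machine load. -/
noncomputable def makespan {n m : ℕ} (p : Fin n → ℝ) (σ : Fin n → Fin m) : ℝ :=
  sSup (Set.range (machineLoad p σ))

/-- A schedule is feasible for cardinality bound `k` if every machine gets at most `k` jobs. -/
def Feasible {n m : ℕ} (k : ℕ) (σ : Fin n → Fin m) : Prop :=
  ∀ i : Fin m, (Finset.univ.filter (fun j => σ j = i)).card ≤ k

/-- The optimal (minimum) makespan over all feasible schedules on `m` machines with
cardinality bound `k`. -/
noncomputable def OPT (m k : ℕ) {n : ℕ} (p : Fin n → ℝ) : ℝ :=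
  sInf ((fun σ : Fin n → Fin m => makespan p σ) '' {σ | Feasible k σ})

/-- The schedule induced by a deterministic online algorithm `A` on input sequence `p`:
job `j` is assigned to the machine `A (p 1, …, p j)`. -/
def onlineSchedule {m : ℕ} (A : List ℝ → Fin m) {n : ℕ} (p : Fin n → ℝ) : Fin n → Fin m :=
  fun j => A ((List.ofFn p).take (j.1 + 1))

/-- An online algorithm is `α`-competitive if on every input sequence of at most `m*k`
nonnegative jobs the induced schedule is feasible and its makespan is at most `α * OPT`. -/
def Competitive (m k : ℕ) (A : List ℝ → Fin m) (α : ℝ) : Prop :=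
  ∀ n : ℕ, n ≤ m * k → ∀ p : Fin n → ℝ, (∀ j, 0 ≤ p j) →
    Feasible k (onlineSchedule A p) ∧
      makespan p (onlineSchedule A p) ≤ α * OPT m k p

/-- The number of jobs that `σ` assigns to machine `i`. -/
def jobCount {n m : ℕ} (σ : Fin n → Fin m) (i : Fin m) : ℕ :=
  (Finset.univ.filter (fun j => σ j = i)).card

theorem sum_jobCount {n m : ℕ} (σ : Fin n → Fin m) : ∑ i, jobCount σ i = n := by
  simpa [jobCount] using
    (Finset.card_eq_sum_card_fiberwise (s := Finset.univ) (t := Finset.univ) (f := σ)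
      (by simp)).symm

theorem jobCount_add {n r m : ℕ} (σ : Fin (n + r) → Fin m) (i : Fin m) :
    jobCount σ i = jobCount (fun j => σ (Fin.castAdd r j)) i +
      jobCount (fun j => σ (Fin.natAdd n j)) i := by
  simp only [jobCount, Finset.card_filter, Fin.sum_univ_add]

theorem machineLoad_append {n r m : ℕ} (u : Fin n → ℝ) (v : Fin r → ℝ)
    (σ : Fin (n + r) → Fin m) (i : Fin m) :
    machineLoad (Fin.append u v) σ i =
      machineLoad u (fun j => σ (Fin.castAdd r j)) i +
        machineLoad v (fun j => σ (Fin.natAdd n j)) i := by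
  simp only [machineLoad, Finset.sum_filter, Fin.sum_univ_add, Fin.append_left, Fin.append_right]

theorem machineLoad_const {n m : ℕ} (c : ℝ) (σ : Fin n → Fin m) (i : Fin m) :
    machineLoad (fun _ => c) σ i = jobCount σ i * c := by
  simp [machineLoad, jobCount]

theorem machineLoad_append_const {n r m : ℕ} (a b : ℝ) (σ : Fin (n + r) → Fin m) (i : Fin m) :
    machineLoad (Fin.append (fun _ => a) (fun _ => b)) σ i =
      jobCount (fun j => σ (Fin.castAdd r j)) i * a +
        jobCount (fun j => σ (Fin.natAdd n j)) i * b := by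
  rw [machineLoad_append, machineLoad_const, machineLoad_const]

theorem machineLoad_le_makespan {n m : ℕ} (p : Fin n → ℝ) (σ : Fin n → Fin m) (i : Fin m) :
    machineLoad p σ i ≤ makespan p σ :=
  le_csSup (Set.finite_range _).bddAbove ⟨i, rfl⟩

theorem size_le_makespan {n m : ℕ} {p : Fin n → ℝ} (hp : ∀ j, 0 ≤ p j) (σ : Fin n → Fin m)
    (j : Fin n) : p j ≤ makespan p σ :=
  (Finset.single_le_sum (fun l _ => hp l) (by simp)).trans (machineLoad_le_makespan p σ (σ j))

theorem OPT_le {n m k : ℕ} [NeZero m] {p : Fin n → ℝ} {σ : Fin n → Fin m} (hσ : Feasible k σ)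
    {c : ℝ} (hc : ∀ i, machineLoad p σ i ≤ c) : OPT m k p ≤ c :=
  (csInf_le (Set.toFinite _).bddBelow (Set.mem_image_of_mem _ hσ)).trans
    (csSup_le (Set.range_nonempty _) (by rintro _ ⟨i, rfl⟩; exact hc i))

theorem size_le_OPT {n m k : ℕ} {p : Fin n → ℝ} (hp : ∀ j, 0 ≤ p j) {σ : Fin n → Fin m}
    (hσ : Feasible k σ) (j : Fin n) : p j ≤ OPT m k p :=
  le_csInf (Set.Nonempty.image _ ⟨σ, hσ⟩) (by rintro _ ⟨τ, -, rfl⟩; exact size_le_makespan hp τ j)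

/-- Decisions of an online algorithm do not depend on later jobs. -/
theorem onlineSchedule_append_castAdd {n r m : ℕ} (A : List ℝ → Fin m) (u : Fin n → ℝ)
    (v : Fin r → ℝ) (j : Fin n) :
    onlineSchedule A (Fin.append u v) (Fin.castAdd r j) = onlineSchedule A u j := by
  have h : j.1 + 1 ≤ (List.ofFn u).length := by simp
  simp only [onlineSchedule, List.ofFn_fin_append, Fin.val_castAdd,
    List.take_append_of_le_length h]

theorem jobCount_id {m : ℕ} (i : Fin m) : jobCount (fun j => j) i = 1 := by
  simp [jobCount, Finset.filter_eq']

theorem jobCount_finProdFinEquiv_fst {m n : ℕ} (i : Fin m) :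
    jobCount (fun j : Fin (m * n) => (finProdFinEquiv.symm j).1) i = n := by
  rw [jobCount, Finset.card_filter,
    Equiv.sum_comp finProdFinEquiv.symm (fun x : Fin m × Fin n => if x.1 = i then 1 else 0),
    Fintype.sum_prod_type, Finset.sum_comm]
  simp

theorem jobCount_finProdFinEquiv_snd_castSucc {m n : ℕ} (i : Fin n) :
    jobCount (fun j : Fin (m * n) => (finProdFinEquiv.symm j).2.castSucc) i.castSucc = m := by
  rw [jobCount, Finset.card_filter, Equiv.sum_comp finProdFinEquiv.symm
    (fun x : Fin m × Fin n => if x.2.castSucc = i.castSucc then 1 else 0), Fintype.sum_prod_type]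
  simp

/-- `k * (k - 1)` unit jobs followed by a job of size `k` can be packed with makespan `k`. -/
theorem exists_feasible_balanced (d : ℕ) :
    ∃ σ : Fin ((d + 1) * d + 1) → Fin (d + 1), Feasible (d + 1) σ ∧
      ∀ i, machineLoad (Fin.append (fun _ => 1) (fun _ => (d : ℝ) + 1)) σ i ≤ d + 1 := by
  refine ⟨Fin.append (fun j => (finProdFinEquiv.symm j).2.castSucc) (fun _ => Fin.last d), ?_, ?_⟩
  · intro i
    change jobCount _ i ≤ _
    rw [jobCount_add]
    simp only [Fin.append_left, Fin.append_right]
    induction i using Fin.lastCases with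
    | last => simp [jobCount, Fin.castSucc_ne_last]
    | cast i =>
      rw [jobCount_finProdFinEquiv_snd_castSucc]
      simp [jobCount, (Fin.castSucc_ne_last i).symm]
  · intro i
    rw [machineLoad_append_const]
    simp only [Fin.append_left, Fin.append_right]
    induction i using Fin.lastCases with
    | last => simp [jobCount, Fin.castSucc_ne_last]
    | cast i =>
      rw [jobCount_finProdFinEquiv_snd_castSucc]
      simp [jobCount, (Fin.castSucc_ne_last i).symm]

/-- `k * (k - 1)` unit jobs followed by `k` jobs of size `M` can be packed with makespan
`M + k - 1`. -/
theorem exists_feasible_spread (d : ℕ) (M : ℝ) :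
    ∃ σ : Fin ((d + 1) * d + (d + 1)) → Fin (d + 1), Feasible (d + 1) σ ∧
      ∀ i, machineLoad (Fin.append (fun _ => 1) (fun _ => M)) σ i ≤ d + M := by
  refine ⟨Fin.append (fun j => (finProdFinEquiv.symm j).1) id, ?_, ?_⟩
  · intro i
    change jobCount _ i ≤ _
    rw [jobCount_add]
    simp only [Fin.append_left, Fin.append_right, jobCount_finProdFinEquiv_fst, id, jobCount_id]
    simp
  · intro i
    rw [machineLoad_append_const]
    simp only [Fin.append_left, Fin.append_right, jobCount_finProdFinEquiv_fst, id, jobCount_id]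
    simp

theorem append_const_nonneg {n r : ℕ} {a b : ℝ} (ha : 0 ≤ a) (hb : 0 ≤ b) (j : Fin (n + r)) :
    0 ≤ Fin.append (fun _ => a) (fun _ => b) j := by
  refine Fin.addCases (fun _ => ?_) (fun _ => ?_) j <;> simpa

/-- If every machine holds `k - 1` of the unit jobs, one job of size `k` is fatal. -/
theorem makespan_of_balanced {d : ℕ} (A : List ℝ → Fin (d + 1))
    (h : ∀ i, jobCount (onlineSchedule A (fun _ : Fin ((d + 1) * d) => (1 : ℝ))) i = d) :
    (2 * d + 1 : ℝ) ≤ makespan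
      (Fin.append (fun _ : Fin ((d + 1) * d) => (1 : ℝ)) (fun _ : Fin 1 => (d : ℝ) + 1))
      (onlineSchedule A (Fin.append (fun _ => 1) (fun _ => (d : ℝ) + 1))) := by
  set τ := onlineSchedule A
    (Fin.append (fun _ : Fin ((d + 1) * d) => (1 : ℝ)) (fun _ : Fin 1 => (d : ℝ) + 1))
  refine le_trans ?_ (machineLoad_le_makespan _ _ (τ (Fin.natAdd _ 0)))
  rw [machineLoad_append_const]
  have hu : (fun j => τ (Fin.castAdd 1 j)) = onlineSchedule A (fun _ => 1) :=
    funext fun j => onlineSchedule_append_castAdd ..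
  have hv : jobCount (fun j => τ (Fin.natAdd ((d + 1) * d) j)) (τ (Fin.natAdd _ 0)) = 1 := by
    simp [jobCount, Finset.filter_singleton]
  rw [hu, h, hv]
  push_cast
  linarith

/-- If some machine is already full, `k` further large jobs force two of them together. -/
theorem makespan_of_full {N k : ℕ} (A : List ℝ → Fin k) (M : ℝ) (i : Fin k)
    (h : k ≤ jobCount (onlineSchedule A (fun _ : Fin N => (1 : ℝ))) i) (hM : 0 ≤ M)
    (hfeas : Feasible k (onlineSchedule A
      (Fin.append (fun _ : Fin N => (1 : ℝ)) (fun _ : Fin k => M)))) :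
    2 * M ≤ makespan (Fin.append (fun _ : Fin N => (1 : ℝ)) (fun _ : Fin k => M))
      (onlineSchedule A (Fin.append (fun _ => 1) (fun _ => M))) := by
  set τ := onlineSchedule A (Fin.append (fun _ : Fin N => (1 : ℝ)) (fun _ : Fin k => M))
  have hu : (fun j => τ (Fin.castAdd k j)) = onlineSchedule A (fun _ => 1) :=
    funext fun j => onlineSchedule_append_castAdd ..
  have hi : jobCount (fun j => τ (Fin.natAdd N j)) i = 0 := by
    have h₁ : jobCount τ i ≤ k := hfeas i
    rw [jobCount_add, hu] at h₁
    omega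
  have hsurj : ¬ Function.Surjective (fun j => τ (Fin.natAdd N j)) := by
    intro hs
    obtain ⟨j, hj⟩ := hs i
    rw [jobCount, Finset.card_eq_zero, Finset.filter_eq_empty_iff] at hi
    exact hi (Finset.mem_univ j) hj
  rw [← Finite.injective_iff_surjective, Function.not_injective_iff] at hsurj
  obtain ⟨j, j', hjj, hne⟩ := hsurj
  have h₂ : 2 ≤ jobCount (fun l => τ (Fin.natAdd N l)) (τ (Fin.natAdd N j)) :=
    Finset.one_lt_card.2 ⟨j, by simp, j', by simpa using hjj.symm, hne⟩
  refine le_trans ?_ (machineLoad_le_makespan _ _ (τ (Fin.natAdd N j)))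
  rw [machineLoad_append_const]
  have h₃ : (2 : ℝ) ≤ jobCount (fun l => τ (Fin.natAdd N l)) (τ (Fin.natAdd N j)) := by
    exact_mod_cast h₂
  have h₄ := mul_le_mul_of_nonneg_right h₃ hM
  have h₅ : (0 : ℝ) ≤ jobCount (fun l => τ (Fin.castAdd k l)) (τ (Fin.natAdd N j)) :=
    Nat.cast_nonneg _
  linarith

/-- The lower bound, witnessed by an input sequence whose optimum is positive; hence no
online algorithm is `α`-competitive for any `α < 2 - 1 / k`. -/
theorem exists_pos_OPT_and_infeasible_or_le_makespan {k : ℕ} (hk : 2 ≤ k)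
    (A : List ℝ → Fin k) :
    ∃ n : ℕ, n ≤ k * k ∧ ∃ p : Fin n → ℝ, (∀ j, 0 ≤ p j) ∧ 0 < OPT k k p ∧
      (¬ Feasible k (onlineSchedule A p) ∨
        (2 - 1 / (k : ℝ)) * OPT k k p ≤ makespan p (onlineSchedule A p)) := by
  obtain ⟨d, rfl⟩ : ∃ d, k = d + 1 := ⟨k - 1, by omega⟩
  have hd : (1 : ℝ) ≤ d := by exact_mod_cast (by omega : 1 ≤ d)
  have hd' : (0 : ℝ) < d + 1 := by linarith
  have hratio : (2 - 1 / ((d + 1 : ℕ) : ℝ)) = (2 * d + 1) / (d + 1) := by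
    push_cast
    field_simp
    ring
  rw [hratio]
  by_cases hfull :
      ∃ i, d + 1 ≤ jobCount (onlineSchedule A (fun _ : Fin ((d + 1) * d) => (1 : ℝ))) i
  · obtain ⟨i, hi⟩ := hfull
    obtain ⟨σ, hσ, hload⟩ := exists_feasible_spread d (2 * (d + 1) ^ 2)
    have hM : (0 : ℝ) < 2 * (d + 1) ^ 2 := by positivity
    have hp := append_const_nonneg (n := (d + 1) * d) (r := d + 1) zero_le_one hM.le
    refine ⟨_, by nlinarith, _, hp, ?_, ?_⟩
    · refine lt_of_lt_of_le ?_ (size_le_OPT hp hσ (Fin.natAdd _ 0))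
      rwa [Fin.append_right]
    · refine or_iff_not_imp_left.2 fun hfeas => ?_
      refine le_trans ?_ (makespan_of_full A _ i hi hM.le (not_not.1 hfeas))
      refine (mul_le_mul_of_nonneg_left (OPT_le hσ hload) (by positivity)).trans ?_
      rw [div_mul_eq_mul_div, div_le_iff₀ hd']
      nlinarith
  · push Not at hfull
    have hbal : ∀ i,
        jobCount (onlineSchedule A (fun _ : Fin ((d + 1) * d) => (1 : ℝ))) i = d := by
      have hle := fun i (_ : i ∈ Finset.univ) => Nat.lt_succ_iff.1 (hfull i)
      simpa using (Finset.sum_eq_sum_iff_of_le hle).1 (by rw [sum_jobCount]; simp)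
    obtain ⟨σ, hσ, hload⟩ := exists_feasible_balanced d
    have hp := append_const_nonneg (n := (d + 1) * d) (r := 1) zero_le_one hd'.le
    refine ⟨_, by nlinarith, _, hp, ?_, Or.inr ?_⟩
    · refine lt_of_lt_of_le ?_ (size_le_OPT hp hσ (Fin.natAdd _ 0))
      rwa [Fin.append_right]
    · refine le_trans ?_ (makespan_of_balanced A hbal)
      refine (mul_le_mul_of_nonneg_left (OPT_le hσ hload) (by positivity)).trans ?_
      rw [div_mul_cancel₀ _ hd'.ne']

/-- For every integer `k ≥ 2` and `m = k` machines, every deterministic online algorithm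
for cardinality constrained scheduling on `k` machines with cardinality bound `k` admits
an input sequence with at most `k*k` jobs on which the induced schedule is infeasible or
has makespan at least `(2 - 1/k) * OPT`. -/
theorem online_lower_bound_two_sub_one_div_k :
    ∀ k : ℕ, 2 ≤ k →
      ∀ A : List ℝ → Fin k,
        ∃ n : ℕ, n ≤ k * k ∧
          ∃ p : Fin n → ℝ, (∀ j, 0 ≤ p j) ∧
            (¬ Feasible k (onlineSchedule A p) ∨
              (2 - 1 / (k : ℝ)) * OPT k k p ≤ makespan p (onlineSchedule A p)) := by
  intro k hk A
  obtain ⟨n, hn, p, hp, -, h⟩ := exists_pos_OPT_and_infeasible_or_le_makespan hk A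
  exact ⟨n, hn, p, hp, h⟩
end

section
/- Let m ≥ 1 and let p₁ ≥ p₂ ≥ … ≥ p_{2m} ≥ 0 be a non-increasing sequence of 2m real job sizes. Consider the schedule σ on m machines that assigns job i to machine i for 1 ≤ i ≤ m and job m + j to machine m + 1 − j for 1 ≤ j ≤ m. Then σ is feasible for cardinality bound k = 2 (each machine receives exactly 2 jobs) and its makespan equals the minimum makespan over all feasible schedules of these 2m jobs on m machines with at most 2 jobs per machine; that is, this ordinal algorithm for k = 2 is optimal. -/
open Finset

/-- The ordinal schedule for `k = 2`: (0-indexed) job `i < m` goes to machine `i`, and job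
`i ≥ m` goes to machine `2*m - 1 - i`; i.e. in 1-indexed terms job `i` goes to machine `i`
for `1 ≤ i ≤ m` and job `m + j` goes to machine `m + 1 - j` for `1 ≤ j ≤ m`. -/
def pairSchedule (m : ℕ) : Fin (2 * m) → Fin m := fun i =>
  if h : i.1 < m then ⟨i.1, h⟩ else ⟨2 * m - 1 - i.1, by have := i.isLt; omega⟩

theorem filter_pairSchedule_eq {m : ℕ} (i : Fin m) :
    (univ.filter fun j => pairSchedule m j = i) =
      {⟨i.1, by omega⟩, ⟨2 * m - 1 - i.1, by omega⟩} := by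
  ext j
  have hj := j.isLt
  have hi := i.isLt
  simp only [mem_filter, mem_univ, true_and, mem_insert, mem_singleton, Fin.ext_iff, pairSchedule]
  split_ifs <;> simp only <;> omega

theorem feasible_pairSchedule (m : ℕ) : Feasible 2 (pairSchedule m) := fun i => by
  rw [filter_pairSchedule_eq]
  exact card_le_two

theorem machineLoad_pairSchedule {m : ℕ} (p : Fin (2 * m) → ℝ) (i : Fin m) :
    machineLoad p (pairSchedule m) i =
      p ⟨i.1, by omega⟩ + p ⟨2 * m - 1 - i.1, by omega⟩ := by
  rw [machineLoad, filter_pairSchedule_eq, sum_pair]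
  simp only [ne_eq, Fin.mk.injEq]
  omega

/-- A feasible schedule of `m * k` jobs fills every machine. -/
theorem Feasible.card_eq {m k n : ℕ} {σ : Fin n → Fin m} (hσ : Feasible k σ) (hn : n = m * k)
    (i : Fin m) : (univ.filter fun j => σ j = i).card = k := by
  have hsum : ∑ i : Fin m, (univ.filter fun j => σ j = i).card = ∑ _i : Fin m, k := by
    rw [← card_eq_sum_card_fiberwise fun _ _ => mem_coe.2 (mem_univ _)]
    simp [hn]
  exact (sum_eq_sum_iff_of_le fun i _ => hσ i).1 hsum i (mem_univ i)

/-- Among the machines of a feasible schedule with two jobs each, some machine gets one of the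
`i + 1` largest jobs together with a job that is not one of the `i` smallest. -/
theorem exists_machineLoad_pairSchedule_le {m : ℕ} {p : Fin (2 * m) → ℝ} (hmono : Antitone p)
    {σ : Fin (2 * m) → Fin m} (hσ : Feasible 2 σ) (i : Fin m) :
    ∃ l, machineLoad p (pairSchedule m) i ≤ machineLoad p σ l := by
  have hi := i.isLt
  let a : Fin (2 * m) := ⟨i.1, by omega⟩
  let c : Fin (2 * m) := ⟨2 * m - 1 - i.1, by omega⟩
  have hac : a < c := by
    simp only [a, c, Fin.mk_lt_mk]
    omega
  let w : Fin (2 * m) → ℤ := fun j => (if j ≤ a then 1 else 0) - (if c < j then 1 else 0)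
  have hw : ∑ j, w j = 1 := by
    have h₁ : univ.filter (fun j => j ≤ a) = Iic a := by ext; simp
    have h₂ : univ.filter (fun j => c < j) = Ioi c := by ext; simp
    simp only [w, sum_sub_distrib, sum_boole, h₁, h₂, Fin.card_Iic, Fin.card_Ioi, a, c]
    omega
  obtain ⟨l, hl⟩ : ∃ l, 0 < ∑ j ∈ univ.filter (fun j => σ j = l), w j := by
    by_contra! h
    have := sum_nonpos fun l (_ : l ∈ univ) => h l
    rw [sum_fiberwise, hw] at this
    omega
  refine ⟨l, ?_⟩
  obtain ⟨x, y, hxy, hfib⟩ := card_eq_two.1 (hσ.card_eq (by ring) l)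
  rw [machineLoad_pairSchedule, machineLoad, hfib, sum_pair hxy]
  rw [hfib, sum_pair hxy] at hl
  change p a + p c ≤ _
  have key : (x ≤ a ∧ y ≤ c) ∨ (y ≤ a ∧ x ≤ c) := by
    simp only [w] at hl
    grind
  rcases key with ⟨h₁, h₂⟩ | ⟨h₁, h₂⟩
  · exact add_le_add (hmono h₁) (hmono h₂)
  · linarith [hmono h₁, hmono h₂]

theorem makespan_pairSchedule_le {m : ℕ} (hm : 1 ≤ m) {p : Fin (2 * m) → ℝ} (hmono : Antitone p)
    {σ : Fin (2 * m) → Fin m} (hσ : Feasible 2 σ) :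
    makespan p (pairSchedule m) ≤ makespan p σ := by
  have : Nonempty (Fin m) := ⟨⟨0, hm⟩⟩
  refine csSup_le (Set.range_nonempty _) ?_
  rintro _ ⟨i, rfl⟩
  obtain ⟨l, hl⟩ := exists_machineLoad_pairSchedule_le hmono hσ i
  exact hl.trans (machineLoad_le_makespan p σ l)

/-- For `m ≥ 1` and non-increasing nonnegative job sizes `p 0 ≥ … ≥ p (2m-1) ≥ 0`, the
schedule assigning (1-indexed) job `i` to machine `i` for `i ≤ m` and job `m + j` to machine
`m + 1 - j` is feasible for cardinality bound `2` and its makespan equals the minimum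
makespan over all feasible schedules; this ordinal algorithm for `k = 2` is optimal. -/
theorem pairSchedule_feasible_and_optimal (m : ℕ) (hm : 1 ≤ m)
    (p : Fin (2 * m) → ℝ) (hmono : Antitone p) (hp : ∀ j, 0 ≤ p j) :
    Feasible 2 (pairSchedule m) ∧
      makespan p (pairSchedule m) = OPT m 2 p := by
  refine ⟨feasible_pairSchedule m, ?_⟩
  refine Eq.symm (IsLeast.csInf_eq ⟨Set.mem_image_of_mem _ (feasible_pairSchedule m), ?_⟩)
  rintro _ ⟨σ, hσ, rfl⟩
  exact makespan_pairSchedule_le hm hmono hσ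
end

section
/- For all positive integers m and k there exists an ordinal algorithm for cardinality constrained scheduling on m machines with cardinality bound k of rate at most 81/41: a fixed assignment σ of positions 1, …, m·k to the m machines with exactly k positions per machine such that for every non-increasing sequence of nonnegative real sizes p₁ ≥ p₂ ≥ … ≥ p_{m·k}, the makespan of the schedule placing the job of size p i on machine σ(i) is at most (81/41)·OPT. -/
open Finset

/-- If at least `u` elements have bound below `u` for every `u ≤ N`, the elements can be ranked
so that every rank respects its lower bound. -/
theorem exists_equiv_fin_forall_le {X : Type*} [Fintype X] {N : ℕ} (hN : Fintype.card X = N)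
    (b : X → ℕ) (h : ∀ u ≤ N, u ≤ #{x | b x < u}) :
    ∃ e : X ≃ Fin N, ∀ x, b x ≤ e x := by
  classical
  let e₀ : X ≃ Fin N := Fintype.equivFinOfCardEq hN
  let f : Fin N → ℕ := fun i => b (e₀.symm i)
  have hmono : Monotone (f ∘ Tuple.sort f) := Tuple.monotone_sort f
  let e : X ≃ Fin N := e₀.trans (Tuple.sort f).symm
  refine ⟨e, fun x => ?_⟩
  by_contra! hx
  have hfe : ∀ y, (f ∘ Tuple.sort f) (e y) = b y := fun y => by simp [f, e]
  have hsub : #{y | b y < (e x : ℕ) + 1} ≤ #(Finset.Iio (e x)) := by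
    refine Finset.card_le_card_of_injOn e (fun y hy => ?_) e.injective.injOn
    have hy' : b y < (e x : ℕ) + 1 := by simpa using hy
    suffices e y < e x by simpa using this
    by_contra! hle
    have := hmono hle
    rw [hfe, hfe] at this
    omega
  have := h ((e x : ℕ) + 1) (e x).2
  rw [Fin.card_Iio] at hsub
  omega

theorem le_card_filter_fin {k c : ℕ} (hc : c ≤ k) {Q : Fin k → Prop} [DecidablePred Q]
    (h : ∀ j : Fin k, (j : ℕ) < c → Q j) : c ≤ #{j | Q j} := by
  calc c = #(Finset.univ.filter fun j : Fin k => (j : ℕ) < c) := by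
        rw [Fin.card_filter_val_lt, min_eq_right hc]
    _ ≤ _ := Finset.card_le_card fun j hj => by
        simp only [Finset.mem_filter, Finset.mem_univ, true_and] at hj ⊢
        exact h j hj

/-- The number of positions outside the tail that a machine receives: the first `d` machines
receive `a` jobs from the tail. -/
def headCount (k a d i : ℕ) : ℕ := if i < d then k - a else k

/-- The smallest position that slot `j` of machine `i` may receive. The first slots receive the
first `m` positions, the other head slots are spread evenly over the head, and the tail is
distributed in blocks of `a` positions to machines `d - 1, …, 0`. -/
def slotBound (m k a d i j : ℕ) : ℕ :=
  if j = 0 then i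
  else if j < headCount k a d i then max m (j * (m * k - a * d) / headCount k a d i)
  else m * k - a * (i + 1)

theorem sum_headCount {m k a d : ℕ} (ha : a ≤ k) (hd : d ≤ m) :
    ∑ i : Fin m, headCount k a d i = m * k - a * d := by
  have h : ∀ i : Fin m, headCount k a d i + (if (i : ℕ) < d then a else 0) = k := by
    intro i
    unfold headCount
    split_ifs <;> omega
  have h2 : ∑ i : Fin m, (if (i : ℕ) < d then a else 0) = a * d := by
    rw [← Finset.sum_filter, Finset.sum_const, Fin.card_filter_val_lt, min_eq_right hd,
      smul_eq_mul, mul_comm]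
  have h3 : ∑ i : Fin m, (headCount k a d i + (if (i : ℕ) < d then a else 0)) = m * k := by
    simp [h]
  rw [Finset.sum_add_distrib, h2] at h3
  omega

theorem le_card_slotBound_lt {m k a d : ℕ} (ha : a < k) (hd : d ≤ m) {u : ℕ} (hu : u ≤ m * k) :
    u ≤ #{x : Fin m × Fin k | slotBound m k a d x.1 x.2 < u} := by
  have hsum : #{x : Fin m × Fin k | slotBound m k a d x.1 x.2 < u}
      = ∑ i : Fin m, #{j : Fin k | slotBound m k a d i j < u} := by
    simp only [Finset.card_filter, Fintype.sum_prod_type]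
  rw [hsum]
  have hr : ∀ i, headCount k a d i ≤ k ∧ 0 < headCount k a d i := by
    intro i
    unfold headCount
    split_ifs <;> omega
  have hT := sum_headCount ha.le hd
  set T := m * k - a * d
  have had : a * d ≤ m * k := by
    calc a * d ≤ k * m := Nat.mul_le_mul ha.le hd
      _ = m * k := mul_comm _ _
  rcases le_or_gt u m with hum | hum
  · calc u = ∑ i : Fin m, (if (i : ℕ) < u then 1 else 0) := by
          rw [← Finset.card_filter, Fin.card_filter_val_lt, min_eq_right hum]
      _ ≤ _ := by
          refine Finset.sum_le_sum fun i _ => ?_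
          split_ifs with hi
          · refine le_card_filter_fin (by omega) fun j hj => ?_
            simp only [slotBound]
            rw [if_pos (by omega)]
            exact hi
          · exact Nat.zero_le _
  rcases le_or_gt u T with huT | huT
  · have hTpos : 0 < T := by omega
    have hi : ∀ i : Fin m,
        u * headCount k a d i ≤ T * #{j : Fin k | slotBound m k a d i j < u} := by
      intro i
      obtain ⟨hrk, hr0⟩ := hr i
      set r := headCount k a d i
      have hle : (u * r + T - 1) / T ≤ #{j : Fin k | slotBound m k a d i j < u} := by
        have hcr : (u * r + T - 1) / T ≤ r := by
          rw [Nat.div_le_iff_le_mul_add_pred hTpos]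
          have := Nat.mul_le_mul_right r huT
          omega
        refine le_card_filter_fin (hcr.trans hrk) fun j hj => ?_
        have hjT : (j : ℕ) * T < u * r := by
          have := (Nat.le_div_iff_mul_le hTpos).1 (Nat.succ_le_of_lt hj)
          rw [Nat.succ_mul] at this
          omega
        simp only [slotBound]
        split_ifs with h1 h2
        · omega
        · exact max_lt hum ((Nat.div_lt_iff_lt_mul hr0).2 hjT)
        · omega
      refine le_trans ?_ (Nat.mul_le_mul_left T hle)
      have h1 := Nat.div_add_mod (u * r + T - 1) T
      have h2 := Nat.mod_lt (u * r + T - 1) hTpos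
      omega
    have := Finset.sum_le_sum fun i (_ : i ∈ (Finset.univ : Finset (Fin m))) => hi i
    rw [← Finset.mul_sum, ← Finset.mul_sum, hT, mul_comm u T] at this
    exact Nat.le_of_mul_le_mul_left this hTpos
  · have hbad : a * #{i : Fin m | a * ((i : ℕ) + 1) ≤ m * k - u} ≤ m * k - u := by
      rcases Nat.eq_zero_or_pos a with rfl | hapos
      · simp
      · have : #{i : Fin m | a * ((i : ℕ) + 1) ≤ m * k - u} ≤ (m * k - u) / a := by
          refine le_trans (Finset.card_le_card_of_injOn (t := Finset.range ((m * k - u) / a))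
            (fun i : Fin m => (i : ℕ)) (fun i hi => ?_) Fin.val_injective.injOn) (by simp)
          have hi' : a * ((i : ℕ) + 1) ≤ m * k - u := by simpa using hi
          simp only [Finset.coe_range, Set.mem_Iio]
          refine Nat.lt_of_succ_le ((Nat.le_div_iff_mul_le hapos).2 ?_)
          rw [mul_comm]
          exact hi'
        exact (Nat.mul_le_mul_left a this).trans (Nat.mul_div_le _ _)
    have hi : ∀ i : Fin m, k ≤ #{j : Fin k | slotBound m k a d i j < u}
        + (if a * ((i : ℕ) + 1) ≤ m * k - u then a else 0) := by
      intro i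
      obtain ⟨hrk, hr0⟩ := hr i
      have hhead : ∀ j : Fin k, (j : ℕ) < headCount k a d i → slotBound m k a d i j < u := by
        intro j hj
        simp only [slotBound]
        rw [if_pos hj]
        split_ifs
        · omega
        · refine max_lt hum (lt_of_le_of_lt (Nat.div_le_of_le_mul ?_) huT)
          exact Nat.mul_le_mul_right _ hj.le
      split_ifs
      · have := le_card_filter_fin (Q := fun j : Fin k => slotBound m k a d i j < u) hrk hhead
        have h3 : k ≤ headCount k a d i + a := by unfold headCount; split_ifs <;> omega
        omega
      · refine le_card_filter_fin (Q := fun j : Fin k => slotBound m k a d i j < u) le_rfl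
          fun j _ => ?_
        by_cases hj : (j : ℕ) < headCount k a d i
        · exact hhead j hj
        · simp only [slotBound]
          rw [if_neg (by omega), if_neg hj]
          have := j.2
          omega
    have h1 := Finset.sum_le_sum fun i (_ : i ∈ (Finset.univ : Finset (Fin m))) => hi i
    rw [Finset.sum_add_distrib, ← Finset.sum_filter, Finset.sum_const, Finset.sum_const,
      smul_eq_mul, smul_eq_mul, Finset.card_univ, Fintype.card_fin, mul_comm _ a] at h1
    omega

theorem sum_range_mul_eq (g : ℕ → ℝ) (n T : ℕ) :
    ∑ s ∈ Finset.range (n * T), g s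
      = ∑ j ∈ Finset.range n, ∑ t ∈ Finset.range T, g (j * T + t) := by
  induction n with
  | zero => simp
  | succ n ih => rw [Nat.succ_mul, Finset.sum_range_add, ih, Finset.sum_range_succ]

/-- Comparison of a sum over `r` evenly spaced positions in `0, …, T - 1` with the sum over all
positions: repeat every position `r` times and cut the result into blocks of length `T`. -/
theorem mul_sum_range_le_of_block {r T : ℕ} {B F : ℕ → ℝ} (hF : ∀ n, 0 ≤ F n)
    (h : ∀ j s, j * T ≤ s → s < (j + 1) * T → B j ≤ F (s / (r + 1))) :
    (T : ℝ) * ∑ j ∈ Finset.range r, B j ≤ (r + 1 : ℕ) * ∑ n ∈ Finset.range T, F n := by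
  have h1 : ∑ s ∈ Finset.range (T * (r + 1)), F (s / (r + 1))
      = (r + 1 : ℕ) * ∑ n ∈ Finset.range T, F n := by
    rw [sum_range_mul_eq, Finset.mul_sum]
    refine Finset.sum_congr rfl fun n _ => ?_
    rw [Finset.sum_congr rfl (g := fun _ => F n), Finset.sum_const, Finset.card_range,
      nsmul_eq_mul]
    intro t ht
    rw [Nat.add_comm, Nat.add_mul_div_right _ _ (Nat.succ_pos r),
      Nat.div_eq_of_lt (Finset.mem_range.1 ht), zero_add]
  rw [← h1, mul_comm T, Nat.succ_mul, Finset.sum_range_add, sum_range_mul_eq, Finset.mul_sum]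
  refine le_add_of_le_of_nonneg (Finset.sum_le_sum fun j _ => ?_)
    (Finset.sum_nonneg fun _ _ => hF _)
  have : ∑ _t ∈ Finset.range T, B j = T * B j := by simp
  rw [← this]
  refine Finset.sum_le_sum fun t ht => h j _ (by omega) ?_
  have := Finset.mem_range.1 ht
  rw [Nat.succ_mul]
  omega

theorem exists_feasible_machineLoad_le_OPT {n m k : ℕ} (p : Fin n → ℝ)
    (h : ∃ σ : Fin n → Fin m, Feasible k σ) :
    ∃ τ : Fin n → Fin m, Feasible k τ ∧ ∀ i, machineLoad p τ i ≤ OPT m k p := by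
  have hmem : OPT m k p ∈ (fun σ : Fin n → Fin m => makespan p σ) '' {σ | Feasible k σ} :=
    Set.Nonempty.csInf_mem (Set.Nonempty.image _ h) (Set.toFinite _)
  obtain ⟨τ, hτ, he⟩ := hmem
  exact ⟨τ, hτ, fun i => (machineLoad_le_makespan p τ i).trans he.le⟩

theorem sum_le_of_machineLoad_le {N m : ℕ} {P : ℕ → ℝ} {τ : Fin N → Fin m} {O : ℝ}
    (hτ : ∀ i, machineLoad (fun j => P j) τ i ≤ O) : ∑ n ∈ Finset.range N, P n ≤ m * O := by
  rw [Finset.sum_range, ← Finset.sum_fiberwise Finset.univ τ]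
  calc _ ≤ ∑ _i : Fin m, O := Finset.sum_le_sum fun i _ => hτ i
    _ = m * O := by simp

/-- Some machine receives `t + 1` of the first `t * m + 1` jobs. -/
theorem succ_mul_le_of_machineLoad_le {N m : ℕ} {P : ℕ → ℝ} (hP : ∀ n, 0 ≤ P n)
    (hanti : Antitone P) {τ : Fin N → Fin m} {O : ℝ}
    (hτ : ∀ i, machineLoad (fun j => P j) τ i ≤ O) {t : ℕ} (ht : t * m < N) :
    (t + 1) * P (t * m) ≤ O := by
  have hcard : #(Finset.Iic (⟨t * m, ht⟩ : Fin N)) = t * m + 1 := by rw [Fin.card_Iic]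
  obtain ⟨i, -, hi⟩ := Finset.exists_lt_card_fiber_of_mul_lt_card_of_maps_to
    (s := Finset.Iic (⟨t * m, ht⟩ : Fin N)) (t := (Finset.univ : Finset (Fin m))) (f := τ)
    (n := t) (fun _ _ => Finset.mem_univ _)
    (by rw [hcard, Finset.card_univ, Fintype.card_fin, mul_comm]; omega)
  refine le_trans ?_ (hτ i)
  set s := (Finset.Iic (⟨t * m, ht⟩ : Fin N)).filter fun j => τ j = i
  calc (t + 1) * P (t * m) ≤ #s * P (t * m) := by
        refine mul_le_mul_of_nonneg_right ?_ (hP _)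
        exact_mod_cast hi
    _ = ∑ _j ∈ s, P (t * m) := by simp
    _ ≤ ∑ j ∈ s, P j := by
        refine Finset.sum_le_sum fun j hj => hanti ?_
        have := Finset.mem_Iic.1 (Finset.mem_filter.1 hj).1
        exact this
    _ ≤ _ := Finset.sum_le_sum_of_subset_of_nonneg
        (Finset.filter_subset_filter _ (Finset.subset_univ _)) fun _ _ _ => hP _

theorem Feasible.card_eq_s9 {m k : ℕ} {τ : Fin (m * k) → Fin m} (hτ : Feasible k τ) (i : Fin m) :
    #{j | τ j = i} = k := by
  have hsum : ∑ i : Fin m, #{j | τ j = i} = ∑ _i : Fin m, k := by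
    rw [← Finset.card_eq_sum_card_fiberwise (f := τ) (s := Finset.univ) (t := Finset.univ)
      (fun _ _ => Finset.mem_coe.2 (Finset.mem_univ _))]
    simp
  exact (Finset.sum_eq_sum_iff_of_le fun i _ => hτ i).1 hsum i (Finset.mem_univ i)

/-- A machine that receives one of the `i + 1` largest jobs receives `k - 1` further jobs, and on
average over these machines at most `a` of them are among the smallest `a * (i + 1)` jobs. -/
theorem add_mul_le_of_machineLoad_le {m k a i : ℕ} {P : ℕ → ℝ} (hP : ∀ n, 0 ≤ P n)
    (hanti : Antitone P) {τ : Fin (m * k) → Fin m} (hf : Feasible k τ) {O : ℝ}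
    (hτ : ∀ i, machineLoad (fun j => P j) τ i ≤ O) (hi : i < m * k) (hk : 2 * a + 1 ≤ k)
    (hq : (2 * a + 1) * P (m * k - a * (i + 1)) ≤ O) :
    P i + a * P (m * k - a * (i + 1)) ≤ O := by
  set e := m * k - a * (i + 1) with he
  set q := P e
  have hq0 : 0 ≤ q := hP e
  rcases lt_or_ge (P i) ((1 + a) * q) with hlt | hge
  · linarith
  set C := (Finset.Iic (⟨i, hi⟩ : Fin (m * k))).image τ
  set S : Finset (Fin (m * k)) := {j | τ j ∈ C} with hS
  have htop : #(Finset.Iic (⟨i, hi⟩ : Fin (m * k))) = i + 1 := by rw [Fin.card_Iic]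
  have hCi : #C ≤ i + 1 := htop ▸ Finset.card_image_le
  have hCpos : 0 < #C := Finset.card_pos.2 (Finset.Nonempty.image ⟨_, Finset.mem_Iic.2 le_rfl⟩ _)
  have hfib : ∀ c ∈ C, S.filter (fun j => τ j = c) = ({j | τ j = c} : Finset _) := by
    intro c hc
    ext j
    simp only [hS, Finset.mem_filter, Finset.mem_univ, true_and]
    exact ⟨fun h => h.2, fun h => ⟨h ▸ hc, h⟩⟩
  have hmaps : ∀ j ∈ S, τ j ∈ C := fun j hj => (Finset.mem_filter.1 hj).2
  have hScard : #S = #C * k := by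
    rw [Finset.card_eq_sum_card_fiberwise (f := τ) (t := C) hmaps,
      Finset.sum_congr rfl (g := fun _ => k) fun c hc => by rw [hfib c hc, hf.card_eq_s9]]
    simp
  have hSsum : ∑ j ∈ S, P j ≤ #C * O := by
    rw [← Finset.sum_fiberwise_of_maps_to hmaps, ← nsmul_eq_mul, ← Finset.sum_const]
    refine Finset.sum_le_sum fun c hc => ?_
    rw [hfib c hc]
    exact hτ c
  have hpt : ∀ j : Fin (m * k), q + (if (j : ℕ) ≤ i then P i - q else 0)
      - (if e ≤ (j : ℕ) then q else 0) ≤ P j := by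
    intro j
    have h1 := hP j
    split_ifs with h2 h3 h3
    · linarith [hanti h2]
    · linarith [hanti h2]
    · linarith
    · linarith [hanti (not_le.1 h3).le]
  have hlow := Finset.sum_le_sum fun j (_ : j ∈ S) => hpt j
  rw [Finset.sum_sub_distrib, Finset.sum_add_distrib, ← Finset.sum_filter, ← Finset.sum_filter,
    Finset.sum_const, Finset.sum_const, Finset.sum_const, nsmul_eq_mul, nsmul_eq_mul,
    nsmul_eq_mul, hScard] at hlow
  have hfil : S.filter (fun j : Fin (m * k) => (j : ℕ) ≤ i) =
      Finset.Iic (⟨i, hi⟩ : Fin (m * k)) := by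
    ext j
    simp only [hS, Finset.mem_filter, Finset.mem_univ, true_and, Finset.mem_Iic]
    refine ⟨fun h => h.2, fun h => ⟨Finset.mem_image_of_mem _ (Finset.mem_Iic.2 h), h⟩⟩
  have htail : #(S.filter fun j : Fin (m * k) => e ≤ (j : ℕ)) ≤ a * (i + 1) := by
    calc _ ≤ #(Finset.Ico e (m * k)) :=
          Finset.card_le_card_of_injOn (fun j : Fin (m * k) => (j : ℕ)) (fun j hj => by
            have := (Finset.mem_filter.1 hj).2
            simp [this]) Fin.val_injective.injOn
      _ ≤ a * (i + 1) := by rw [Nat.card_Ico]; omega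
  rw [hfil, htop] at hlow
  have htail' : (#(S.filter fun j : Fin (m * k) => e ≤ (j : ℕ)) : ℝ) * q ≤ a * (i + 1) * q :=
    mul_le_mul_of_nonneg_right (by exact_mod_cast htail) hq0
  push_cast at hlow
  have hCi' : (#C : ℝ) ≤ i + 1 := by exact_mod_cast hCi
  have hCpos' : (0 : ℝ) < #C := by exact_mod_cast hCpos
  have hk' : (2 * a + 1 : ℝ) ≤ k := by exact_mod_cast hk
  have hmul : (#C : ℝ) * (P i - (1 + a) * q) ≤ (i + 1) * (P i - (1 + a) * q) :=
    mul_le_mul_of_nonneg_right hCi' (by linarith)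
  have hkq : (2 * a + 1) * q ≤ k * q := mul_le_mul_of_nonneg_right hk' hq0
  have hfin : (#C : ℝ) * (P i - (1 + a) * q + k * q) ≤ #C * O := by linarith
  have := le_of_mul_le_mul_left hfin hCpos'
  linarith

theorem sum_slotBound_eq {m k a d i r : ℕ} (P : ℕ → ℝ) (hr : headCount k a d i = r + 1)
    (hrk : r + 1 ≤ k) :
    ∑ j ∈ Finset.range k, P (slotBound m k a d i j)
      = P i + ∑ j ∈ Finset.range r, P (max m ((j + 1) * (m * k - a * d) / (r + 1)))
        + (k - (r + 1) : ℕ) * P (m * k - a * (i + 1)) := by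
  obtain ⟨b, rfl⟩ := Nat.exists_eq_add_of_le hrk
  rw [Finset.sum_range_add, Finset.sum_range_succ', add_comm (P i)]
  congr 1
  · congr 1
    refine Finset.sum_congr rfl fun j hj => ?_
    have := Finset.mem_range.1 hj
    simp only [slotBound, hr]
    rw [if_neg (by omega), if_pos (by omega)]
  · rw [Nat.add_sub_cancel_left, Finset.sum_congr rfl (g := fun _ =>
      P (m * (r + 1 + b) - a * (i + 1))), Finset.sum_const, Finset.card_range, nsmul_eq_mul]
    intro j _
    simp only [slotBound, hr]
    rw [if_neg (by omega), if_neg (by omega)]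

/-- Machines whose largest job is not among the first `d` jobs. -/
theorem sum_slotBound_le_of_le {m k : ℕ} (hk : 0 < k) {P : ℕ → ℝ} (hP : ∀ n, 0 ≤ P n)
    (hanti : Antitone P) {O : ℝ} (hO : ∀ t : ℕ, (t + 1) * P (t * m) ≤ O)
    (hS : ∑ n ∈ Finset.range (m * k), P n ≤ m * O) {i : ℕ} (hi : i < m)
    (hdi : (m - 1) / 2 ≤ i) :
    ∑ j ∈ Finset.range k, P (slotBound m k (k / 4) ((m - 1) / 2) i j) ≤ 81 / 41 * O := by
  set a := k / 4 with ha
  set d := (m - 1) / 2 with hd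
  obtain ⟨r, rfl⟩ := Nat.exists_eq_succ_of_ne_zero hk.ne'
  rw [sum_slotBound_eq P (r := r) (by unfold headCount; rw [if_neg (by omega)]) le_rfl]
  set T := m * (r + 1) - a * d with hT
  have h0 := hO 0
  have h1 := hO 1
  simp only [Nat.cast_zero, zero_add, zero_mul, one_mul, Nat.cast_one] at h0 h1
  have hPd : P d ≤ O := (hanti (Nat.zero_le d)).trans h0
  have hO0 : 0 ≤ O := (hP 0).trans h0
  have hPdm : P m ≤ P d := hanti (by omega)
  have had : 8 * (a * d) ≤ m * (r + 1) := by
    calc 8 * (a * d) = (4 * a) * (2 * d) := by ring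
      _ ≤ (r + 1) * m := Nat.mul_le_mul (by omega) (by omega)
      _ = m * (r + 1) := mul_comm _ _
  have hmm : m ≤ m * (r + 1) := Nat.le_mul_of_pos_right m hk
  have hdT : d + 1 ≤ T := by omega
  let F : ℕ → ℝ := fun n => P n - (if n < d + 1 then P d - P m else 0)
  have hFm : ∀ n, n < d + 1 → P m ≤ F n := by
    intro n hn
    simp only [F, if_pos hn]
    linarith [hanti (Nat.lt_succ_iff.1 hn)]
  have hF : ∀ n, 0 ≤ F n := by
    intro n
    by_cases hn : n < d + 1
    · exact (hP m).trans (hFm n hn)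
    · simp only [F, if_neg hn, sub_zero]
      exact hP n
  have hblock := mul_sum_range_le_of_block (r := r) (T := T)
    (B := fun j => P (max m ((j + 1) * T / (r + 1)))) hF (fun j s _ hs => by
      by_cases hn : s / (r + 1) < d + 1
      · exact (hanti (le_max_left _ _)).trans (hFm _ hn)
      · simp only [F, if_neg hn, sub_zero]
        exact hanti ((Nat.div_le_div_right hs.le).trans (le_max_right _ _)))
  have hFsum : ∑ n ∈ Finset.range T, F n
      = ∑ n ∈ Finset.range T, P n - (d + 1 : ℕ) * (P d - P m) := by
    simp only [F]
    rw [Finset.sum_sub_distrib, ← Finset.sum_filter, Finset.sum_const, nsmul_eq_mul]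
    congr 3
    rw [show (Finset.range T).filter (fun n => n < d + 1) = Finset.range (d + 1) by
      ext n; simp only [Finset.mem_filter, Finset.mem_range]; omega, Finset.card_range]
  have hST : ∑ n ∈ Finset.range T, P n ≤ m * O :=
    (Finset.sum_le_sum_of_subset_of_nonneg (Finset.range_subset_range.2 (Nat.sub_le _ _))
      fun _ _ _ => hP _).trans hS
  rw [hFsum] at hblock
  have hPi : P i ≤ P d := hanti hdi
  rw [Nat.sub_self, Nat.cast_zero, zero_mul, add_zero]
  set A := ∑ j ∈ Finset.range r, P (max m ((j + 1) * T / (r + 1)))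
  have hkd : (r + 1) * (d + 1) ≤ T := by
    have h2 : 2 * ((r + 1) * (d + 1)) ≤ (r + 1) * (m + 1) := by
      calc _ = (r + 1) * (2 * (d + 1)) := by ring
        _ ≤ _ := Nat.mul_le_mul_left _ (by omega)
    rcases Nat.lt_or_ge m 2 with hm | hm
    · have : d = 0 := by omega
      have h3 : m = 1 := by omega
      rw [hT, this, h3]
      simp
    · have h3 : (r + 1) * (m + 1) = m * (r + 1) + (r + 1) := by ring
      have h4 : 2 * (r + 1) ≤ m * (r + 1) := Nat.mul_le_mul_right _ hm
      omega
  have hkd' : ((r + 1 : ℕ) : ℝ) * (d + 1 : ℕ) ≤ T := by exact_mod_cast hkd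
  have hT7 : (7 / 8 : ℝ) * (m * (r + 1 : ℕ)) ≤ T := by
    have : 7 * (m * (r + 1)) ≤ 8 * T := by omega
    have : (7 * (m * (r + 1 : ℕ)) : ℝ) ≤ 8 * T := by exact_mod_cast this
    linarith
  have hmd : (m : ℝ) * (r + 1 : ℕ) ≤ 2 * ((r + 1 : ℕ) * (d + 1 : ℕ)) := by
    have : m * (r + 1) ≤ 2 * ((r + 1) * (d + 1)) := by
      calc m * (r + 1) ≤ (2 * (d + 1)) * (r + 1) := Nat.mul_le_mul_right _ (by omega)
        _ = _ := by ring
    exact_mod_cast this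
  have hTpos : (0 : ℝ) < T := by exact_mod_cast (show 0 < T by omega)
  set K : ℝ := ((r + 1 : ℕ) : ℝ)
  set c : ℝ := ((d + 1 : ℕ) : ℝ)
  have hK0 : 0 ≤ K := by positivity
  have hc0 : 0 ≤ c := by positivity
  have e1 : (T - K * c) * P d ≤ (T - K * c) * O :=
    mul_le_mul_of_nonneg_left hPd (by linarith)
  have e2 : K * c * P m ≤ K * c * (O / 2) :=
    mul_le_mul_of_nonneg_left (by linarith) (by positivity)
  have e3 : K * ∑ n ∈ Finset.range T, P n ≤ K * (m * O) := mul_le_mul_of_nonneg_left hST hK0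
  have e4 : T * P i ≤ T * P d := mul_le_mul_of_nonneg_left hPi hTpos.le
  have e5 : m * K * O ≤ 2 * (K * c) * O := mul_le_mul_of_nonneg_right hmd hO0
  have e6 : (7 / 8 : ℝ) * (m * K) * O ≤ T * O := mul_le_mul_of_nonneg_right hT7 hO0
  refine le_of_mul_le_mul_left ?_ hTpos
  have e7 : 0 ≤ T * O := by positivity
  nlinarith

/-- Machines that receive jobs from the tail. -/
theorem sum_slotBound_le_of_lt {m k : ℕ} (hk : 4 ≤ k) {P : ℕ → ℝ} (hP : ∀ n, 0 ≤ P n)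
    (hanti : Antitone P) {O : ℝ}
    (hS : ∑ n ∈ Finset.range (m * k), P n ≤ m * O) {i : ℕ} (hdi : i < (m - 1) / 2)
    (hq : P i + (k / 4 : ℕ) * P (m * k - k / 4 * (i + 1)) ≤ O) :
    ∑ j ∈ Finset.range k, P (slotBound m k (k / 4) ((m - 1) / 2) i j) ≤ 81 / 41 * O := by
  set a := k / 4 with ha
  set d := (m - 1) / 2 with hd
  obtain ⟨r, hr⟩ := Nat.exists_eq_succ_of_ne_zero (show k - a ≠ 0 by omega)
  rw [sum_slotBound_eq P (r := r) (by unfold headCount; rw [if_pos hdi, hr]) (by omega)]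
  set T := m * k - a * d with hT
  have hO0 : 0 ≤ O := by
    have h1 := hP i
    have h2 := hP (m * k - a * (i + 1))
    exact le_trans (by positivity) hq
  have hblock := mul_sum_range_le_of_block (r := r) (T := T)
    (B := fun j => P (max m ((j + 1) * T / (r + 1)))) hP (fun j s _ hs =>
      hanti ((Nat.div_le_div_right hs.le).trans (le_max_right _ _)))
  have hST : ∑ n ∈ Finset.range T, P n ≤ m * O :=
    (Finset.sum_le_sum_of_subset_of_nonneg (Finset.range_subset_range.2 (Nat.sub_le _ _))
      fun _ _ _ => hP _).trans hS
  have had : 2 * (a * d) ≤ m * a := by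
    calc 2 * (a * d) = (2 * d) * a := by ring
      _ ≤ m * a := Nat.mul_le_mul_right _ (by omega)
  have hmk : 41 * (m * (r + 1)) ≤ 40 * T := by
    have h1 : m * (r + 1) + m * a = m * k := by rw [← mul_add]; congr 1; omega
    have h2 : m * k ≤ 21 * (m * a) := by
      calc m * k ≤ m * (21 * a) := Nat.mul_le_mul_left _ (by omega)
        _ = _ := by ring
    omega
  have hTpos' : 0 < T := by
    have : 0 < m * (r + 1) := Nat.mul_pos (by omega) (by omega)
    omega
  have hTpos : (0 : ℝ) < T := by exact_mod_cast hTpos'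
  have hmk' : (41 * (m * (r + 1 : ℕ)) : ℝ) ≤ 40 * T := by exact_mod_cast hmk
  rw [show k - (r + 1) = a by omega]
  set A := ∑ j ∈ Finset.range r, P (max m ((j + 1) * T / (r + 1)))
  have e3 : ((r + 1 : ℕ) : ℝ) * ∑ n ∈ Finset.range T, P n ≤ (r + 1 : ℕ) * (m * O) :=
    mul_le_mul_of_nonneg_left hST (by positivity)
  have e4 : (41 * (m * (r + 1 : ℕ)) : ℝ) * O ≤ 40 * T * O := mul_le_mul_of_nonneg_right hmk' hO0
  have e5 : T * A ≤ T * (40 / 41 * O) := by linarith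
  have := le_of_mul_le_mul_left e5 hTpos
  linarith

theorem sum_slotBound_le_of_lt_four {m k : ℕ} (hk : 0 < k) (hk4 : k < 4) {P : ℕ → ℝ}
    (hanti : Antitone P) {O : ℝ} (hO : ∀ t : ℕ, (t + 1) * P (t * m) ≤ O) (hO0 : 0 ≤ O)
    (d i : ℕ) :
    ∑ j ∈ Finset.range k, P (slotBound m k (k / 4) d i j) ≤ 81 / 41 * O := by
  have h0 := hO 0
  have h1 := hO 1
  have h2 := hO 2
  simp only [Nat.cast_zero, zero_add, zero_mul, one_mul, Nat.cast_one, Nat.cast_ofNat] at h0 h1 h2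
  have hi := hanti (Nat.zero_le i)
  have hk0 : k / 4 = 0 := by omega
  have hb : ∀ j, j < k → j ≠ 0 → P (slotBound m k (k / 4) d i j) ≤ P (j * m) := by
    intro j hj hj0
    refine hanti ?_
    have : headCount k 0 d i = k := by simp [headCount]
    simp only [slotBound, hk0, this, if_neg hj0, if_pos hj, zero_mul, Nat.sub_zero]
    rw [← mul_assoc, Nat.mul_div_cancel _ hk]
    exact le_max_right _ _
  have hb0 : P (slotBound m k (k / 4) d i 0) = P i := by simp [slotBound]
  interval_cases k
  · rw [Finset.sum_range_one, hb0]
    linarith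
  · rw [Finset.sum_range_succ, Finset.sum_range_one, hb0]
    have := hb 1 (by norm_num) (by norm_num)
    rw [one_mul] at this
    linarith
  · rw [Finset.sum_range_succ, Finset.sum_range_succ, Finset.sum_range_one, hb0]
    have := hb 1 (by norm_num) (by norm_num)
    rw [one_mul] at this
    have := hb 2 (by norm_num) (by norm_num)
    linarith

/-- For all positive `m` and `k` there is an ordinal algorithm of rate at most `81/41`:
a fixed assignment `σ` of the positions `1, …, m*k` to the `m` machines with exactly `k`
positions per machine such that for every non-increasing sequence of nonnegative sizes the
makespan of the induced schedule is at most `(81/41) * OPT`. -/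
theorem exists_ordinal_algorithm_rate_81_div_41 (m k : ℕ) (hm : 0 < m) (hk : 0 < k) :
    ∃ σ : Fin (m * k) → Fin m,
      (∀ i : Fin m, (Finset.univ.filter (fun j => σ j = i)).card = k) ∧
      ∀ p : Fin (m * k) → ℝ, (∀ j, 0 ≤ p j) → Antitone p →
        makespan p σ ≤ (81 / 41) * OPT m k p := by
  obtain ⟨e, he⟩ := exists_equiv_fin_forall_le (X := Fin m × Fin k) (N := m * k) (by simp) _
    fun u hu => le_card_slotBound_lt (a := k / 4) (d := (m - 1) / 2) (by omega) (by omega) hu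
  let σ : Fin (m * k) → Fin m := fun t => (e.symm t).1
  have hfib : ∀ (i : Fin m) (f : Fin (m * k) → ℝ),
      ∑ t ∈ Finset.univ.filter (fun t => σ t = i), f t = ∑ j : Fin k, f (e (i, j)) := by
    intro i f
    rw [Finset.sum_filter, ← e.sum_comp, Fintype.sum_prod_type]
    simp only [σ, Equiv.symm_apply_apply]
    rw [Finset.sum_eq_single i (fun x _ hx => by simp [hx]) (by simp)]
    simp
  have hcard : ∀ i : Fin m, (Finset.univ.filter (fun j => σ j = i)).card = k := by
    intro i
    have := hfib i fun _ => 1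
    simp only [Finset.sum_const, nsmul_eq_mul, mul_one, Finset.card_univ, Fintype.card_fin] at this
    exact_mod_cast this
  refine ⟨σ, hcard, fun p hp hpanti => ?_⟩
  obtain ⟨P, hpP, hP, hanti, hPz⟩ : ∃ P : ℕ → ℝ, (∀ j : Fin (m * k), p j = P j) ∧ (∀ n, 0 ≤ P n) ∧
      Antitone P ∧ ∀ n, m * k ≤ n → P n = 0 := by
    refine ⟨fun n => if h : n < m * k then p ⟨n, h⟩ else 0, fun j => by simp, fun n => ?_,
      fun x y hxy => ?_, fun n hn => by simp [hn]⟩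
    · dsimp only
      split_ifs
      exacts [hp _, le_rfl]
    · dsimp only
      split_ifs with h1 h2
      · exact hpanti hxy
      · omega
      · exact hp _
      · exact le_rfl
  obtain rfl : p = fun j : Fin (m * k) => P j := funext hpP
  obtain ⟨τ, hf, hτ⟩ := exists_feasible_machineLoad_le_OPT (k := k) (fun j : Fin (m * k) => P j)
    ⟨σ, fun i => (hcard i).le⟩
  set O := OPT m k fun j : Fin (m * k) => P j
  have hO0 : 0 ≤ O := (Finset.sum_nonneg fun _ _ => hP _).trans (hτ ⟨0, hm⟩)
  have hO : ∀ t : ℕ, (t + 1) * P (t * m) ≤ O := by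
    intro t
    rcases lt_or_ge (t * m) (m * k) with ht | ht
    · exact succ_mul_le_of_machineLoad_le hP hanti hτ ht
    · rw [hPz _ ht, mul_zero]
      exact hO0
  have hS := sum_le_of_machineLoad_le hτ
  have : Nonempty (Fin m) := ⟨⟨0, hm⟩⟩
  refine csSup_le (Set.range_nonempty _) ?_
  rintro _ ⟨i, rfl⟩
  have hload : machineLoad (fun j : Fin (m * k) => P j) σ i
      ≤ ∑ j ∈ Finset.range k, P (slotBound m k (k / 4) ((m - 1) / 2) i j) := by
    rw [machineLoad, hfib i, Finset.sum_range]
    exact Finset.sum_le_sum fun j _ => hanti (he (i, j))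
  refine hload.trans ?_
  rcases lt_or_ge k 4 with hk4 | hk4
  · exact sum_slotBound_le_of_lt_four hk hk4 hanti hO hO0 _ _
  rcases lt_or_ge (i : ℕ) ((m - 1) / 2) with hi | hi
  · refine sum_slotBound_le_of_lt hk4 hP hanti hS hi ?_
    refine add_mul_le_of_machineLoad_le hP hanti hf hτ
      (i.2.trans_le (Nat.le_mul_of_pos_right m hk)) (by omega) ?_
    have hle : 2 * (k / 4) * m ≤ m * k - k / 4 * (i + 1) := by
      have h1 : 4 * (k / 4 * m) ≤ m * k := by
        calc 4 * (k / 4 * m) = m * (4 * (k / 4)) := by ring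
          _ ≤ m * k := Nat.mul_le_mul_left _ (by omega)
      have h2 : k / 4 * (i + 1) ≤ k / 4 * m := Nat.mul_le_mul_left _ i.2
      have h3 : 2 * (k / 4) * m = 2 * (k / 4 * m) := by ring
      omega
    refine le_trans (mul_le_mul_of_nonneg_left (hanti hle) (by positivity)) ?_
    have := hO (2 * (k / 4))
    push_cast at this ⊢
    exact this
  · exact sum_slotBound_le_of_le hk hP hanti hO hS i.2 hi
end

section
/- Fix an integer k ≥ 3 and define ι : {s ∈ ℕ : s ≥ 2} → ℕ by ι(2) = ⌈(k−1)/3⌉ and ι(s+1) = ⌈(k − 1 − ι(s)) / 2⌉ for s ≥ 2. Then for every s ≥ 2: if (k−1) mod 3 = 1 and s is odd, then ι(s) = ⌊(k−1)/3⌋; otherwise ι(s) = ⌈(k−1)/3⌉. -/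
theorem ceil_div_two_eq_ediv (a : ℤ) : ⌈(a : ℚ) / 2⌉ = (a + 1) / 2 := by
  rw [Int.ceil_eq_iff, lt_div_iff₀ two_pos, div_le_iff₀ two_pos]
  norm_cast
  omega

theorem ceil_div_three_eq_ediv (a : ℤ) : ⌈(a : ℚ) / 3⌉ = (a + 2) / 3 := by
  rw [Int.ceil_eq_iff, lt_div_iff₀ three_pos, div_le_iff₀ three_pos]
  norm_cast
  omega

theorem floor_div_three_eq_ediv (a : ℤ) : ⌊(a : ℚ) / 3⌋ = a / 3 := by
  rw [Int.floor_eq_iff, div_lt_iff₀ three_pos, le_div_iff₀ three_pos]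
  norm_cast
  omega

/-- Fix `k ≥ 3` and let `ι` satisfy `ι 2 = ⌈(k-1)/3⌉` and `ι (s+1) = ⌈(k-1-ι s)/2⌉` for
`s ≥ 2` (ceilings of exact rational divisions).  Then for every `s ≥ 2`: if
`(k-1) % 3 = 1` and `s` is odd then `ι s = ⌊(k-1)/3⌋`, and otherwise `ι s = ⌈(k-1)/3⌉`. -/
theorem iota_pattern (k : ℕ) (hk : 3 ≤ k) (ι : ℕ → ℕ)
    (h2 : (ι 2 : ℤ) = ⌈((k : ℚ) - 1) / 3⌉)
    (hrec : ∀ s : ℕ, 2 ≤ s → (ι (s + 1) : ℤ) = ⌈((k : ℚ) - 1 - (ι s : ℚ)) / 2⌉) :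
    ∀ s : ℕ, 2 ≤ s →
      (((k - 1) % 3 = 1 ∧ Odd s) → (ι s : ℤ) = ⌊((k : ℚ) - 1) / 3⌋) ∧
      (¬ ((k - 1) % 3 = 1 ∧ Odd s) → (ι s : ℤ) = ⌈((k : ℚ) - 1) / 3⌉) := by
  have hceil := ceil_div_three_eq_ediv ((k : ℤ) - 1)
  have hfloor := floor_div_three_eq_ediv ((k : ℤ) - 1)
  push_cast at hceil hfloor
  rw [hceil] at h2
  rw [hceil, hfloor]
  intro s hs
  induction s, hs using Nat.le_induction with
  | base =>
    exact ⟨fun h => absurd h.2 (by decide), fun _ => h2⟩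
  | succ s hs ih =>
    have hstep := hrec s hs
    have hhalf := ceil_div_two_eq_ediv ((k : ℤ) - 1 - ι s)
    push_cast at hhalf
    rw [hhalf] at hstep
    rw [Nat.odd_iff] at ih ⊢
    omega
end

section
/- Fix an integer k ≥ 3 and define ι : {s ∈ ℕ : s ≥ 2} → ℕ by ι(2) = ⌈(k−1)/3⌉ and ι(s+1) = ⌈(k − 1 − ι(s)) / 2⌉ for s ≥ 2. Then for every s ≥ 2, the number (k − 1) − ι(s) is even if and only if (k−1) mod 3 = 0, or both (k−1) mod 3 = 1 and s is even. -/
/-- The value of the ceiling of `a / b` for integers `a` and `b > 0`, as integer inequalities. -/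
theorem Int.eq_ceil_div_iff {a b z : ℤ} (hb : 0 < b) :
    z = ⌈(a : ℚ) / b⌉ ↔ b * (z - 1) < a ∧ a ≤ b * z := by
  have hb' : (0 : ℚ) < b := by exact_mod_cast hb
  rw [eq_comm, Int.ceil_eq_iff, lt_div_iff₀' hb', div_le_iff₀' hb']
  norm_cast

/-- Fix `k ≥ 3` and let `ι` satisfy `ι 2 = ⌈(k-1)/3⌉` and `ι (s+1) = ⌈(k-1-ι s)/2⌉` for
`s ≥ 2` (ceilings of exact rational divisions).  Then for every `s ≥ 2`, the number
`(k - 1) - ι s` is even if and only if `(k-1) % 3 = 0`, or both `(k-1) % 3 = 1` and `s`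
is even. -/
theorem iota_even_odd (k : ℕ) (hk : 3 ≤ k) (ι : ℕ → ℕ)
    (h2 : (ι 2 : ℤ) = ⌈((k : ℚ) - 1) / 3⌉)
    (hrec : ∀ s : ℕ, 2 ≤ s → (ι (s + 1) : ℤ) = ⌈((k : ℚ) - 1 - (ι s : ℚ)) / 2⌉) :
    ∀ s : ℕ, 2 ≤ s →
      (Even ((k : ℤ) - 1 - (ι s : ℤ)) ↔
        ((k - 1) % 3 = 0 ∨ ((k - 1) % 3 = 1 ∧ Even s))) := by
  have h2' : 3 * ((ι 2 : ℤ) - 1) < (k : ℤ) - 1 ∧ (k : ℤ) - 1 ≤ 3 * ι 2 :=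
    (Int.eq_ceil_div_iff (by norm_num)).1 (by push_cast; exact h2)
  have hrec' (s : ℕ) (hs : 2 ≤ s) : 2 * ((ι (s + 1) : ℤ) - 1) < (k : ℤ) - 1 - ι s ∧
      (k : ℤ) - 1 - ι s ≤ 2 * ι (s + 1) :=
    (Int.eq_ceil_div_iff (by norm_num)).1 (by push_cast; exact hrec s hs)
  have key (s : ℕ) (hs : 2 ≤ s) :
      ((k - 1) % 3 = 0 ∧ 3 * ι s = k - 1) ∨
      ((k - 1) % 3 = 1 ∧ s % 2 = 0 ∧ 3 * ι s = k + 1) ∨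
      ((k - 1) % 3 = 1 ∧ s % 2 = 1 ∧ 3 * ι s = k - 2) ∨
      ((k - 1) % 3 = 2 ∧ 3 * ι s = k) := by
    induction s, hs using Nat.le_induction with
    | base => omega
    | succ s hs ih =>
      have := hrec' s hs
      omega
  intro s hs
  have := key s hs
  rw [Int.even_iff, Nat.even_iff]
  omega
end

section
/- Fix an integer k ≥ 3 and define ι : {s ∈ ℕ : s ≥ 2} → ℕ by ι(2) = ⌈(k−1)/3⌉ and ι(s+1) = ⌈(k − 1 − ι(s)) / 2⌉ for s ≥ 2, and set ψ(s) = ⌊(ι(s) − 2)/3⌋ (floor taken in the integers, so ψ(s) may be negative). Then for every s ≥ 2: ψ(s) ≥ ⌊(k−6)/9⌋ and k − 1 − ψ(s) ≤ (8k + 6)/9. -/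
/-- Fix `k ≥ 3`, let `ι` satisfy `ι 2 = ⌈(k-1)/3⌉` and `ι (s+1) = ⌈(k-1-ι s)/2⌉` for
`s ≥ 2`, and set `ψ s = ⌊(ι s - 2)/3⌋` (an integer, possibly negative).  Then for every
`s ≥ 2` we have `ψ s ≥ ⌊(k-6)/9⌋` and `k - 1 - ψ s ≤ (8k+6)/9` (as rational numbers). -/
theorem psi_bounds (k : ℕ) (hk : 3 ≤ k) (ι : ℕ → ℕ)
    (h2 : (ι 2 : ℤ) = ⌈((k : ℚ) - 1) / 3⌉)
    (hrec : ∀ s : ℕ, 2 ≤ s → (ι (s + 1) : ℤ) = ⌈((k : ℚ) - 1 - (ι s : ℚ)) / 2⌉) :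
    ∀ s : ℕ, 2 ≤ s →
      ⌊((k : ℚ) - 6) / 9⌋ ≤ ⌊((ι s : ℚ) - 2) / 3⌋ ∧
      (k : ℚ) - 1 - (⌊((ι s : ℚ) - 2) / 3⌋ : ℚ) ≤ (8 * (k : ℚ) + 6) / 9 := by
  have key : ∀ s : ℕ, 2 ≤ s → (k : ℤ) - 2 ≤ 3 * ι s ∧ 3 * (ι s : ℤ) ≤ k + 1 := by
    intro s hs
    induction s, hs using Nat.le_induction with
    | base =>
      obtain ⟨h, h'⟩ := Int.ceil_eq_iff.mp h2.symm
      rw [lt_div_iff₀ (by norm_num)] at h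
      rw [div_le_iff₀ (by norm_num)] at h'
      have h₁ : ((ι 2 : ℤ) - 1) * 3 < k - 1 := by exact_mod_cast h
      have h₂ : (k : ℤ) - 1 ≤ ι 2 * 3 := by exact_mod_cast h'
      omega
    | succ s hs ih =>
      obtain ⟨h, h'⟩ := Int.ceil_eq_iff.mp (hrec s hs).symm
      rw [lt_div_iff₀ (by norm_num)] at h
      rw [div_le_iff₀ (by norm_num)] at h'
      have h₁ : ((ι (s + 1) : ℤ) - 1) * 2 < k - 1 - ι s := by exact_mod_cast h
      have h₂ : (k : ℤ) - 1 - ι s ≤ ι (s + 1) * 2 := by exact_mod_cast h'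
      omega
  intro s hs
  have hι := key s hs
  have hk' : ⌊((k : ℚ) - 6) / 9⌋ = ((k : ℤ) - 6) / 9 := by
    exact_mod_cast Rat.floor_intCast_div_natCast ((k : ℤ) - 6) 9
  have hψ : ⌊((ι s : ℚ) - 2) / 3⌋ = ((ι s : ℤ) - 2) / 3 := by
    exact_mod_cast Rat.floor_intCast_div_natCast ((ι s : ℤ) - 2) 3
  rw [hk', hψ]
  refine ⟨by omega, ?_⟩
  have h : (k : ℤ) - 15 ≤ 9 * (((ι s : ℤ) - 2) / 3) := by omega
  have h' : (k : ℚ) - 15 ≤ 9 * ((((ι s : ℤ) - 2) / 3 : ℤ) : ℚ) := by exact_mod_cast h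
  linarith
end

section
/- Let m, k, m' be positive integers with m' ≤ m, and let p₁ ≥ p₂ ≥ … ≥ p_{m·k} ≥ 0 be a non-increasing sequence of m·k real job sizes. Then every feasible schedule σ of these m·k jobs on m machines with at most k jobs per machine satisfies makespan(σ) ≥ ( (Σ_{i=1}^{m'} p_i) + (Σ_{i = m·k − (k−1)·m' + 1}^{m·k} p_i) ) / m'; that is, the makespan is at least the total size of the m' largest jobs plus the total size of the (k−1)·m' smallest jobs, divided by m'. -/
open Finset

/-- If every value of a nonnegative `f` on `s` is at most every value on `t`, and `t` has at least
as many elements, then the sum over `s` is at most the sum over `t`. -/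
theorem Finset.sum_le_sum_of_card_le_of_forall_le {ι : Type*} {f : ι → ℝ} {s t : Finset ι}
    (hf : ∀ i, 0 ≤ f i) (hcard : #s ≤ #t) (h : ∀ i ∈ s, ∀ j ∈ t, f i ≤ f j) :
    ∑ i ∈ s, f i ≤ ∑ j ∈ t, f j := by
  rcases s.eq_empty_or_nonempty with rfl | hs
  · simpa using Finset.sum_nonneg fun i _ => hf i
  · obtain ⟨a, ha, hmax⟩ := s.exists_max_image f hs
    calc ∑ i ∈ s, f i ≤ #s • f a := Finset.sum_le_card_nsmul _ _ _ hmax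
      _ ≤ #t • f a := nsmul_le_nsmul_left (hf a) hcard
      _ ≤ ∑ j ∈ t, f j := Finset.card_nsmul_le_sum _ _ _ (h a ha)

/-- For nonincreasing nonnegative `p`, a final segment of indices has sum at most that of any
set of at least the same cardinality. -/
theorem Antitone.sum_final_segment_le {n N : ℕ} {p : Fin n → ℝ} (hmono : Antitone p)
    (hp : ∀ j, 0 ≤ p j) {s : Finset (Fin n)} (hcard : n - N ≤ #s) :
    ∑ i ∈ univ.filter (fun i : Fin n => N ≤ i.1), p i ≤ ∑ i ∈ s, p i := by
  set b := univ.filter (fun i : Fin n => N ≤ i.1) with hb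
  have hbcard : #b ≤ n - N := by
    have hsub : b.map Fin.valEmbedding ⊆ Finset.Ico N n := by
      intro x hx
      obtain ⟨i, hi, rfl⟩ := Finset.mem_map.mp hx
      exact Finset.mem_Ico.mpr ⟨(Finset.mem_filter.mp hi).2, i.2⟩
    simpa using Finset.card_le_card hsub
  have hdiff : ∑ i ∈ b \ s, p i ≤ ∑ i ∈ s \ b, p i := by
    refine Finset.sum_le_sum_of_card_le_of_forall_le hp ?_ fun i hi j hj => hmono ?_
    · have h₁ := Finset.card_sdiff_add_card_inter b s
      have h₂ := Finset.card_sdiff_add_card_inter s b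
      rw [Finset.inter_comm] at h₂
      omega
    · simp only [hb, Finset.mem_sdiff, Finset.mem_filter, Finset.mem_univ, true_and] at hi hj
      exact Fin.le_def.mpr (by omega)
  have h₁ := Finset.sum_inter_add_sum_sdiff b s p
  have h₂ := Finset.sum_inter_add_sum_sdiff s b p
  rw [Finset.inter_comm] at h₂
  linarith

/-- The total size of the jobs on the machines in `M` is at most `#M` times the makespan. -/
theorem sum_filter_mem_le_card_mul_makespan {n m : ℕ} (p : Fin n → ℝ) (σ : Fin n → Fin m)
    (M : Finset (Fin m)) :
    ∑ j ∈ univ.filter (fun j => σ j ∈ M), p j ≤ #M * makespan p σ := by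
  have h : ∑ i ∈ M, machineLoad p σ i = ∑ j ∈ univ.filter (fun j => σ j ∈ M), p j := by
    simpa only [machineLoad] using Finset.sum_fiberwise_eq_sum_filter univ M σ p
  rw [← h, ← nsmul_eq_mul]
  exact Finset.sum_le_card_nsmul _ _ _ fun i _ => machineLoad_le_makespan p σ i

theorem Feasible.card_filter_mem_le {n m k : ℕ} {σ : Fin n → Fin m} (hσ : Feasible k σ)
    (M : Finset (Fin m)) : #(univ.filter (fun j => σ j ∈ M)) ≤ k * #M :=
  Finset.card_le_mul_card_image_of_maps_to (f := σ) (by simp) k fun i _ =>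
    (Finset.card_le_card (Finset.filter_subset_filter _ (Finset.filter_subset _ _))).trans (hσ i)

/-- When the number of jobs is `m * k`, the machines in `M` receive at least `k * #M` jobs. -/
theorem Feasible.mul_card_le_card_filter_mem {m k : ℕ} {σ : Fin (m * k) → Fin m}
    (hσ : Feasible k σ) (M : Finset (Fin m)) :
    k * #M ≤ #(univ.filter (fun j => σ j ∈ M)) := by
  have h₁ := hσ.card_filter_mem_le Mᶜ
  have h₂ := Finset.card_filter_add_card_filter_not (s := univ) (fun j => σ j ∈ M)
  have h₃ := Finset.card_add_card_compl M
  simp only [Finset.mem_compl] at h₁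
  simp only [Finset.card_univ, Fintype.card_fin] at h₂ h₃
  have h₄ : k * #M + k * #Mᶜ = m * k := by rw [← mul_add, h₃, mul_comm]
  omega

/-- For non-increasing nonnegative sizes `p 0 ≥ … ≥ p (m*k - 1)` and any `1 ≤ m' ≤ m`, every
feasible schedule of the `m*k` jobs on `m` machines with at most `k` jobs per machine has
makespan at least `(total size of the m' largest jobs + total size of the (k-1)*m' smallest
jobs) / m'`. -/
theorem makespan_lower_bound_largest_plus_smallest
    (m k m' : ℕ) (hm : 0 < m) (hk : 0 < k) (hm'pos : 0 < m') (hm'le : m' ≤ m)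
    (p : Fin (m * k) → ℝ) (hmono : Antitone p) (hp : ∀ j, 0 ≤ p j)
    (σ : Fin (m * k) → Fin m) (hσ : Feasible k σ) :
    ((∑ i ∈ Finset.univ.filter (fun i : Fin (m * k) => i.1 < m'), p i) +
        ∑ i ∈ Finset.univ.filter (fun i : Fin (m * k) => m * k - (k - 1) * m' ≤ i.1), p i) /
        (m' : ℝ)
      ≤ makespan p σ := by
  set T := univ.filter (fun i : Fin (m * k) => i.1 < m') with hT
  have hTcard : #T ≤ m' := by
    rw [hT, Fin.card_filter_val_lt]
    exact min_le_right _ _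
  obtain ⟨M, hTM, hM⟩ : ∃ M : Finset (Fin m), T.image σ ⊆ M ∧ #M = m' :=
    Finset.exists_superset_card_eq (Finset.card_image_le.trans hTcard) (by simpa using hm'le)
  set J := univ.filter (fun j => σ j ∈ M) with hJ
  have hTJ : T ⊆ J := fun j hj => by
    simpa [hJ] using hTM (Finset.mem_image_of_mem σ hj)
  have hJcard : k * m' ≤ #J := hM ▸ hσ.mul_card_le_card_filter_mem M
  have hrest : m * k - (m * k - (k - 1) * m') ≤ #(J \ T) := by
    have h₁ := Finset.card_sdiff_add_card_eq_card hTJ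
    have h₂ : (k - 1) * m' + m' = k * m' := by
      rw [← Nat.succ_mul, Nat.succ_eq_add_one, Nat.sub_add_cancel hk]
    omega
  have hsmall := hmono.sum_final_segment_le hp hrest
  have hload := sum_filter_mem_le_card_mul_makespan p σ M
  have hsplit := Finset.sum_sdiff (f := p) hTJ
  rw [hM] at hload
  rw [div_le_iff₀' (by exact_mod_cast hm'pos)]
  linarith
end

section
/- Let M, N be positive integers, A an M × N matrix with integer entries, b, b' ∈ ℤ^M, and c ∈ ℤ^N. Let IntSol(A, b, c) denote the set of vectors x ∈ ℤ^N with x ≥ 0 componentwise, A·x = b, and cᵀx ≤ cᵀy for every y ∈ ℤ^N with y ≥ 0 and A·y = b. Let Δ be the maximum absolute value of an entry of A. If both IntSol(A, b, c) and IntSol(A, b', c) are non-empty, then for every x ∈ IntSol(A, b, c) there exists y ∈ IntSol(A, b', c) with ‖x − y‖_∞ ≤ (‖b − b'‖_∞ + 2) · N · Δ^M · M^{M/2}, where ‖·‖_∞ is the maximum absolute value of a coordinate and the inequality is an inequality of real numbers. -/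
theorem Matrix.abs_det_le_prod_sqrt_mul_of_fin {n : ℕ} (B : Matrix (Fin n) (Fin n) ℝ)
    (x : Fin n → ℝ) (hx : ∀ j, 0 ≤ x j) (hB : ∀ i j, |B i j| ≤ x j) :
    |B.det| ≤ ∏ j, (Real.sqrt n * x j) := by
  let b := EuclideanSpace.basisFun (Fin n) ℝ
  have : Fact (Module.finrank ℝ (EuclideanSpace ℝ (Fin n)) = n) := ⟨by simp⟩
  let v : Fin n → EuclideanSpace ℝ (Fin n) := fun j => WithLp.toLp 2 (B.col j)
  have hdet : b.toBasis.det v = B.det := by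
    rw [Module.Basis.det_apply]
    congr 1
  rw [← hdet, ← b.toBasis.orientation.volumeForm_robust' b]
  refine (Orientation.abs_volumeForm_apply_le _ v).trans ?_
  refine Finset.prod_le_prod (fun _ _ => norm_nonneg _) fun j _ => ?_
  rw [EuclideanSpace.norm_eq]
  calc Real.sqrt (∑ i, ‖v j i‖ ^ 2) ≤ Real.sqrt (∑ _i : Fin n, x j ^ 2) := by
        refine Real.sqrt_le_sqrt (Finset.sum_le_sum fun i _ => ?_)
        exact pow_le_pow_left₀ (norm_nonneg _) (hB i j) 2
    _ = Real.sqrt n * x j := by simp [Real.sqrt_sq (hx j)]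

/-- Hadamard's determinant inequality, with a bound for the entries of each column. -/
theorem Matrix.abs_det_le_prod_sqrt_card_mul {ι : Type*} [Fintype ι] [DecidableEq ι]
    (B : Matrix ι ι ℝ) (x : ι → ℝ) (hx : ∀ j, 0 ≤ x j) (hB : ∀ i j, |B i j| ≤ x j) :
    |B.det| ≤ ∏ j, (Real.sqrt (Fintype.card ι) * x j) := by
  let e := (Fintype.equivFin ι).symm
  rw [← Matrix.det_submatrix_equiv_self e B, ← e.prod_comp]
  exact Matrix.abs_det_le_prod_sqrt_mul_of_fin _ (x ∘ e) (fun _ => hx _) fun _ _ => hB _ _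

theorem Matrix.exists_submatrix_det_ne_zero {m ι K : Type*} [Fintype m] [Fintype ι]
    [DecidableEq ι] [Field K] (A : Matrix m ι K) (hA : Function.Injective A.mulVec) :
    ∃ r : ι → m, (A.submatrix r id).det ≠ 0 := by
  have hrank : A.rank = Fintype.card ι := by
    rw [← Matrix.rank_transpose]
    exact (Matrix.mulVec_injective_iff.1 hA).rank_matrix
  obtain ⟨κ, a, ha, hspan, hli⟩ := exists_linearIndependent' K A.row
  have := Finite.of_injective a ha
  have := Fintype.ofFinite κ
  have hcard : Fintype.card ι = Fintype.card κ := by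
    rw [← hrank, Matrix.rank_eq_finrank_span_row, ← hspan, finrank_span_eq_card hli]
  let e := Fintype.equivOfCardEq hcard
  refine ⟨a ∘ e, ?_⟩
  rw [← isUnit_iff_ne_zero, ← Matrix.isUnit_iff_isUnit_det,
    ← Matrix.linearIndependent_rows_iff_isUnit]
  exact hli.comp e e.injective

/-- Moving a nonnegative vector along a direction with a positive entry, until the first entry
vanishes, keeps it nonnegative and shrinks its support. -/
theorem exists_sub_smul_nonneg {ι K : Type*} [Fintype ι] [Field K] [LinearOrder K]
    [IsStrictOrderedRing K] {v w : ι → K} (hv : 0 ≤ v)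
    (hwv : Function.support w ⊆ Function.support v) (hw : ∃ i, 0 < w i) :
    ∃ t : K, 0 ≤ t ∧ 0 ≤ v - t • w ∧
      Function.support (v - t • w) ⊂ Function.support v := by
  classical
  obtain ⟨k, hk⟩ := hw
  obtain ⟨i, hi, hmin⟩ := (Finset.univ.filter fun i => 0 < w i).exists_min_image
    (fun i => v i / w i) ⟨k, by simpa using hk⟩
  simp only [Finset.mem_filter, Finset.mem_univ, true_and] at hi hmin
  have ht : 0 ≤ v i / w i := div_nonneg (hv i) hi.le
  refine ⟨v i / w i, ht, fun j => ?_, ?_⟩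
  · simp only [Pi.zero_apply, Pi.sub_apply, Pi.smul_apply, smul_eq_mul, sub_nonneg]
    rcases lt_or_ge 0 (w j) with h | h
    · exact (le_div_iff₀ h).1 (hmin j h)
    · exact (mul_nonpos_of_nonneg_of_nonpos ht h).trans (hv j)
  · refine (Set.ssubset_iff_of_subset fun j hj => ?_).2 ⟨i, hwv hi.ne', ?_⟩
    · by_contra h
      have hvj : v j = 0 := by simpa using h
      have hwj : w j = 0 := by simpa using fun h' => h (hwv h')
      simp [hvj, hwj] at hj
    · simp [hi.ne']

section Sensitivity

variable {m n : Type*} [Fintype m] [Fintype n] [DecidableEq n]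

/-- Cramer's rule on independent columns: they contain a nonzero minor of full width, and it
determines every vector supported on them from its image. -/
theorem exists_minor_cramer {K : Type*} [Field K] (A : Matrix m n K) (T : Finset n)
    (hT : ∀ w : n → K, Function.support w ⊆ T → A.mulVec w = 0 → w = 0) :
    ∃ r : T → m, (A.submatrix r Subtype.val).det ≠ 0 ∧ Fintype.card T ≤ Fintype.card m ∧
      ∀ v : n → K, Function.support v ⊆ T → ∀ i : T,
        (A.submatrix r Subtype.val).det * v i =
          ((A.submatrix r Subtype.val).updateCol i fun k => A.mulVec v (r k)).det := by
  have hres (v : n → K) (hv : Function.support v ⊆ T) (k : m) :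
      A.mulVec v k = (A.submatrix id (Subtype.val : T → n)).mulVec (fun i => v i) k := by
    simp only [Matrix.mulVec, dotProduct, Matrix.submatrix_apply, id]
    rw [Finset.sum_coe_sort T (fun j => A k j * v j)]
    refine (Finset.sum_subset (Finset.subset_univ T) fun j _ hj => ?_).symm
    rw [show v j = 0 by simpa using fun h => hj (hv h), mul_zero]
  have hinj : Function.Injective (A.submatrix id (Subtype.val : T → n)).mulVec := by
    refine (injective_iff_map_eq_zero (A.submatrix id (Subtype.val : T → n)).mulVecLin).2
      fun w hw => ?_
    let v : n → K := fun i => if h : i ∈ T then w ⟨i, h⟩ else 0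
    have hvT : Function.support v ⊆ T := fun i hi => by
      by_contra h
      exact hi (dif_neg h)
    have hvw : (fun i : T => v i) = w := funext fun i => dif_pos i.2
    have hv : v = 0 := hT v hvT (funext fun k => by
      rw [hres v hvT, hvw]
      exact congrFun hw k)
    rw [← hvw, hv]
    rfl
  obtain ⟨r, hr⟩ := (A.submatrix id (Subtype.val : T → n)).exists_submatrix_det_ne_zero hinj
  refine ⟨r, hr, ?_, fun v hv i => ?_⟩
  · refine Fintype.card_le_of_injective r fun a b hab => ?_
    by_contra hne
    exact hr (Matrix.det_zero_of_row_eq hne (by ext; simp [hab]))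
  · rw [← Matrix.cramer_apply, Matrix.cramer_eq_adjugate_mulVec]
    have : (fun k => A.mulVec v (r k)) =
        (A.submatrix r (Subtype.val : T → n)).mulVec fun i => v i := by
      ext k
      rw [hres v hv]
      rfl
    rw [this, Matrix.mulVec_mulVec, Matrix.adjugate_mul]
    simp [Matrix.smul_mulVec]

theorem abs_det_le_mul {ι : Type*} [Fintype ι] [DecidableEq ι] {Δ β : ℝ} {p : ℕ} (hΔ : 1 ≤ Δ)
    (hι : Fintype.card ι ≤ p) (hβ : 0 ≤ β) (B : Matrix ι ι ℝ) (i₀ : ι)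
    (h : ∀ i j, j ≠ i₀ → |B i j| ≤ Δ) (h₀ : ∀ i, |B i i₀| ≤ β * Δ) :
    |B.det| ≤ β * (Δ ^ p * Real.sqrt p ^ p) := by
  have hΔ0 : 0 ≤ Δ := zero_le_one.trans hΔ
  have hp : 1 ≤ p := (Fintype.card_pos_iff.2 ⟨i₀⟩).trans_le hι
  have hsqrt : 1 ≤ Real.sqrt p := Real.one_le_sqrt.2 (by exact_mod_cast hp)
  have hx (j : ι) : 0 ≤ Function.update (fun _ => Δ) i₀ (β * Δ) j := by
    rcases eq_or_ne j i₀ with rfl | hj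
    · simpa using mul_nonneg hβ hΔ0
    · simpa [hj] using hΔ0
  refine (B.abs_det_le_prod_sqrt_card_mul (Function.update (fun _ => Δ) i₀ (β * Δ)) hx
    fun i j => ?_).trans ?_
  · rcases eq_or_ne j i₀ with rfl | hj
    · simpa using h₀ i
    · simpa [hj] using h i j hj
  · have hprod : ∏ j, Function.update (fun _ => Δ) i₀ (β * Δ) j = β * Δ ^ Fintype.card ι := by
      rw [Finset.prod_update_of_mem (Finset.mem_univ i₀), Finset.prod_const, mul_assoc,
        ← pow_succ', Finset.card_sdiff_of_subset (Finset.subset_univ _), Finset.card_singleton,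
        Finset.card_univ, Nat.sub_add_cancel (Fintype.card_pos_iff.2 ⟨i₀⟩)]
    rw [Finset.prod_mul_distrib, hprod, Finset.prod_const, Finset.card_univ]
    calc Real.sqrt (Fintype.card ι) ^ Fintype.card ι * (β * Δ ^ Fintype.card ι)
        = β * (Δ ^ Fintype.card ι * Real.sqrt (Fintype.card ι) ^ Fintype.card ι) := by ring
      _ ≤ β * (Δ ^ p * Real.sqrt p ^ p) := by
        have h1 : Δ ^ Fintype.card ι ≤ Δ ^ p := pow_le_pow_right₀ hΔ hι
        have h2 : Real.sqrt (Fintype.card ι) ^ Fintype.card ι ≤ Real.sqrt p ^ p :=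
          (pow_le_pow_left₀ (Real.sqrt_nonneg _)
            (Real.sqrt_le_sqrt (by exact_mod_cast hι)) _).trans (pow_le_pow_right₀ hsqrt hι)
        gcongr

theorem abs_det_le_pow_mul_sqrt_pow {ι : Type*} [Fintype ι] [DecidableEq ι] {Δ : ℝ} {p : ℕ}
    (hΔ : 1 ≤ Δ) (hp : 0 < p) (hι : Fintype.card ι ≤ p) (B : Matrix ι ι ℝ)
    (h : ∀ i j, |B i j| ≤ Δ) :
    |B.det| ≤ Δ ^ p * Real.sqrt p ^ p := by
  rcases isEmpty_or_nonempty ι with _ | ⟨⟨i₀⟩⟩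
  · rw [Matrix.det_isEmpty, abs_one]
    exact one_le_mul_of_one_le_of_one_le (one_le_pow₀ hΔ)
      (one_le_pow₀ (Real.one_le_sqrt.2 (by exact_mod_cast hp)))
  · simpa using abs_det_le_mul hΔ hι zero_le_one B i₀ (fun i j _ => h i j)
      (by simpa using fun i => h i i₀)

theorem abs_le_of_support_independent {A : Matrix m n ℤ} {Δ β : ℝ} (hΔ : 1 ≤ Δ)
    (hA : ∀ i j, |(A i j : ℝ)| ≤ Δ) {T : Finset n}
    (hT : ∀ w : n → ℝ, Function.support w ⊆ T → (A.map (Int.cast : ℤ → ℝ)).mulVec w = 0 → w = 0)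
    {v : n → ℝ} (hv : Function.support v ⊆ T) (hβ : 0 ≤ β)
    (hAv : ∀ i, |(A.map (Int.cast : ℤ → ℝ)).mulVec v i| ≤ β) (j : n) :
    |v j| ≤ β * (Δ ^ Fintype.card m * Real.sqrt (Fintype.card m) ^ Fintype.card m) := by
  by_cases hj : j ∈ T
  · obtain ⟨r, hr, hcard, hcramer⟩ := exists_minor_cramer _ T hT
    have hD : ((A.map (Int.cast : ℤ → ℝ)).submatrix r (Subtype.val : T → n)).det =
        ((A.submatrix r (Subtype.val : T → n)).det : ℤ) := by
      rw [Int.cast_det]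
      rfl
    have hD1 : 1 ≤ |((A.map (Int.cast : ℤ → ℝ)).submatrix r (Subtype.val : T → n)).det| := by
      rw [hD] at hr ⊢
      exact_mod_cast Int.one_le_abs (Int.cast_ne_zero.1 hr)
    calc |v j| ≤ |((A.map (Int.cast : ℤ → ℝ)).submatrix r (Subtype.val : T → n)).det| * |v j| :=
          le_mul_of_one_le_left (abs_nonneg _) hD1
      _ = _ := by rw [← abs_mul, hcramer v hv ⟨j, hj⟩]
      _ ≤ _ := abs_det_le_mul hΔ hcard hβ _ ⟨j, hj⟩
          (fun i k hk => by simpa [Matrix.updateCol_ne hk] using hA (r i) k)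
          (fun i => by simpa using (hAv (r i)).trans (le_mul_of_one_le_right hβ hΔ))
  · have : v j = 0 := by simpa using fun h => hj (hv h)
    rw [this, abs_zero]
    positivity

/-- Cramer's rule for a circuit: a kernel vector whose support is independent up to one column
has a positive multiple with integer entries bounded by the minors of the matrix. -/
theorem exists_int_multiple_of_mulVec_eq_zero {A : Matrix m n ℤ} {Δ : ℝ} (hΔ : 1 ≤ Δ)
    (hm : 0 < Fintype.card m) (hA : ∀ i j, |(A i j : ℝ)| ≤ Δ) {T : Finset n}
    (hT : ∀ w : n → ℝ, Function.support w ⊆ T → (A.map (Int.cast : ℤ → ℝ)).mulVec w = 0 → w = 0)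
    {u : n → ℝ} {k : n} (hk : 0 < u k) (huT : Function.support u ⊆ insert k T) (hkT : k ∉ T)
    (hu : (A.map (Int.cast : ℤ → ℝ)).mulVec u = 0) :
    ∃ c : ℝ, 0 < c ∧ ∃ z : n → ℤ, (∀ i, (z i : ℝ) = c * u i) ∧
      ∀ i, (z i : ℝ) ≤ Δ ^ Fintype.card m * Real.sqrt (Fintype.card m) ^ Fintype.card m := by
  obtain ⟨r, hr, hcard, hcramer⟩ := exists_minor_cramer _ T hT
  set B := A.submatrix r (Subtype.val : T → n) with hB
  have hcast : (A.map (Int.cast : ℤ → ℝ)).submatrix r (Subtype.val : T → n) =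
      B.map (Int.cast : ℤ → ℝ) := rfl
  have hdet : (B.map (Int.cast : ℤ → ℝ)).det = (B.det : ℤ) := (Int.cast_det B).symm
  have hDle : |(B.det : ℝ)| ≤ _ := hdet ▸ abs_det_le_pow_mul_sqrt_pow hΔ hm hcard
    (B.map (Int.cast : ℤ → ℝ)) fun i j => hA (r i) j
  rw [hcast, hdet] at hr
  have hentry (i : T) : (B.det : ℝ) * u i =
      -u k * ((B.updateCol i fun t => A (r t) k).det : ℤ) := by
    have hsup : Function.support (u - u k • Pi.single k (1 : ℝ)) ⊆ T := fun j hj => by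
      rcases eq_or_ne j k with rfl | hjk
      · simp at hj
      · have : u j ≠ 0 := by simpa [hjk] using hj
        exact (huT this).resolve_left hjk
    have hik : (i : n) ≠ k := fun h => hkT (h ▸ i.2)
    have h := hcramer _ hsup i
    rw [Matrix.mulVec_sub, hu, Matrix.mulVec_smul, Matrix.mulVec_single_one] at h
    have hcol : (fun t => (0 - u k • (A.map (Int.cast : ℤ → ℝ)).col k) (r t)) =
        (-u k) • fun t => (A (r t) k : ℝ) := by
      ext t
      simp
    rw [hcol, Matrix.det_updateCol_smul, hcast, hdet] at h
    rw [Int.cast_det (B.updateCol i _), Matrix.map_updateCol]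
    exact (by simp [hik] : _ = _).trans h
  obtain ⟨s, hs, hsD⟩ : ∃ s : ℤ, |(s : ℝ)| = 1 ∧ |(B.det : ℝ)| = s * B.det := by
    rcases abs_choice (B.det : ℝ) with h | h
    · exact ⟨1, by simp, by simpa using h⟩
    · exact ⟨-1, by simp, by simpa using h⟩
  have hex (i : n) : ∃ z : ℤ, (z : ℝ) = |(B.det : ℝ)| / u k * u i ∧
      (z : ℝ) ≤ Δ ^ Fintype.card m * Real.sqrt (Fintype.card m) ^ Fintype.card m := by
    by_cases hi : i ∈ T
    · refine ⟨-s * (B.updateCol ⟨i, hi⟩ fun t => A (r t) k).det, ?_, ?_⟩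
      · rw [hsD, div_mul_eq_mul_div, mul_assoc, hentry ⟨i, hi⟩]
        field_simp
        push_cast
        ring
      · refine (le_abs_self _).trans ?_
        rw [Int.cast_mul, Int.cast_neg, abs_mul, abs_neg, hs, one_mul, Int.cast_det]
        refine abs_det_le_pow_mul_sqrt_pow hΔ hm hcard _ fun a b => ?_
        rcases eq_or_ne b ⟨i, hi⟩ with rfl | hb
        · simpa using hA (r a) k
        · simpa [hb, hB] using hA (r a) b
    · rcases eq_or_ne i k with rfl | hik
      · refine ⟨|B.det|, ?_, ?_⟩
        · rw [div_mul_cancel₀ _ hk.ne', Int.cast_abs]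
        · rwa [Int.cast_abs]
      · have hui : u i = 0 := by
          by_contra h
          exact (huT h).elim hik hi
        refine ⟨0, by simp [hui], ?_⟩
        rw [Int.cast_zero]
        positivity
  choose z hz hz' using hex
  exact ⟨_, div_pos (abs_pos.2 hr) hk, z, hz, hz'⟩

theorem exists_int_circuit {A : Matrix m n ℤ} {Δ : ℝ} (hΔ : 1 ≤ Δ)
    (hm : 0 < Fintype.card m) (hA : ∀ i j, |(A i j : ℝ)| ≤ Δ) {u : n → ℝ} (hu : 0 ≤ u)
    (hu0 : u ≠ 0) (hAu : (A.map (Int.cast : ℤ → ℝ)).mulVec u = 0) :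
    ∃ z : n → ℤ, z ≠ 0 ∧ 0 ≤ z ∧ A.mulVec z = 0 ∧ Function.support z ⊆ Function.support u ∧
      ∀ i, (z i : ℝ) ≤ Δ ^ Fintype.card m * Real.sqrt (Fintype.card m) ^ Fintype.card m := by
  induction hc : (Function.support u).ncard using Nat.strong_induction_on generalizing u with
  | _ c ih =>
  obtain ⟨k, hk⟩ := Function.ne_iff.1 hu0
  have hk : 0 < u k := lt_of_le_of_ne (hu k) (Ne.symm hk)
  set T : Finset n := {i | u i ≠ 0 ∧ i ≠ k} with hTdef
  by_cases hT : ∀ w : n → ℝ, Function.support w ⊆ T →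
      (A.map (Int.cast : ℤ → ℝ)).mulVec w = 0 → w = 0
  · obtain ⟨c, hc, z, hz, hzle⟩ := exists_int_multiple_of_mulVec_eq_zero hΔ hm hA hT hk
      (fun i hi => by
        rcases eq_or_ne i k with rfl | hik
        · simp
        · exact Or.inr (by simpa [hTdef, hik] using hi))
      (by simp [hTdef]) hAu
    have hzu : (fun i => (z i : ℝ)) = c • u := funext hz
    refine ⟨z, ?_, fun i => ?_, ?_, fun i hi => ?_, hzle⟩
    · rintro rfl
      exact (mul_pos hc hk).ne (by simpa using hz k)
    · exact_mod_cast (hz i).symm ▸ mul_nonneg hc.le (hu i)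
    · ext i
      have h : (A.map (Int.cast : ℤ → ℝ)).mulVec (fun i => (z i : ℝ)) i = 0 := by
        rw [hzu, Matrix.mulVec_smul, hAu, smul_zero, Pi.zero_apply]
      have h' : ((A.mulVec z i : ℤ) : ℝ) = 0 := by
        rw [← h]
        simp [Matrix.mulVec, dotProduct]
      exact_mod_cast h'
    · intro h
      have := hz i
      rw [h, mul_zero] at this
      exact hi (by exact_mod_cast this)
  · push Not at hT
    obtain ⟨w, hwT, hAw, hw0⟩ := hT
    obtain ⟨w, hwT, hAw, hpos⟩ : ∃ w : n → ℝ, Function.support w ⊆ T ∧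
        (A.map (Int.cast : ℤ → ℝ)).mulVec w = 0 ∧ ∃ i, 0 < w i := by
      obtain ⟨i, hi⟩ := Function.ne_iff.1 hw0
      rcases lt_or_gt_of_ne hi with h | h
      · exact ⟨-w, by simpa using hwT, by simp [Matrix.mulVec_neg, hAw], i, by simpa using h⟩
      · exact ⟨w, hwT, hAw, i, h⟩
    have hTu : (T : Set n) ⊆ Function.support u := fun i hi => by
      have h : u i ≠ 0 ∧ i ≠ k := by simpa [hTdef] using hi
      exact h.1
    obtain ⟨t, -, hnn, hss⟩ := exists_sub_smul_nonneg hu (hwT.trans hTu) hpos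
    have hwk : w k = 0 := by
      by_contra h
      simpa [hTdef] using hwT h
    obtain ⟨z, hz0, hz, hAz, hzs, hzle⟩ := ih _ (hc ▸ Set.ncard_lt_ncard hss) hnn
      (fun h => hk.ne' (by simpa [hwk] using congrFun h k))
      (by simp [Matrix.mulVec_sub, Matrix.mulVec_smul, hAu, hAw]) rfl
    exact ⟨z, hz0, hz, hAz, hzs.trans hss.subset, hzle⟩

theorem le_of_no_nonneg_kernel {A : Matrix m n ℤ} {Δ β : ℝ} (hΔ : 1 ≤ Δ)
    (hA : ∀ i j, |(A i j : ℝ)| ≤ Δ) (hβ : 0 ≤ β) {v : n → ℝ} (hv : 0 ≤ v)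
    (hAv : ∀ i, |(A.map (Int.cast : ℤ → ℝ)).mulVec v i| ≤ β)
    (hker : ∀ u : n → ℝ, 0 ≤ u → Function.support u ⊆ Function.support v →
      (A.map (Int.cast : ℤ → ℝ)).mulVec u = 0 → u = 0) (j : n) :
    v j ≤ β * (Δ ^ Fintype.card m * Real.sqrt (Fintype.card m) ^ Fintype.card m) := by
  induction hc : (Function.support v).ncard using Nat.strong_induction_on generalizing v with
  | _ c ih =>
  by_cases hT : ∀ w : n → ℝ, Function.support w ⊆ (Finset.univ.filter fun i => v i ≠ 0 : Finset n) →
      (A.map (Int.cast : ℤ → ℝ)).mulVec w = 0 → w = 0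
  · exact (le_abs_self _).trans
      (abs_le_of_support_independent hΔ hA hT (fun i hi => by simpa using hi) hβ hAv j)
  · push Not at hT
    obtain ⟨w, hwT, hAw, hw0⟩ := hT
    replace hwT : Function.support w ⊆ Function.support v := fun i hi => by simpa using hwT hi
    obtain ⟨w, hwT, hAw, hw0, hwj⟩ : ∃ w : n → ℝ, Function.support w ⊆ Function.support v ∧
        (A.map (Int.cast : ℤ → ℝ)).mulVec w = 0 ∧ w ≠ 0 ∧ w j ≤ 0 := by
      rcases le_total (w j) 0 with h | h
      · exact ⟨w, hwT, hAw, hw0, h⟩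
      · exact ⟨-w, by simpa using hwT, by simp [Matrix.mulVec_neg, hAw], by simpa using hw0,
          by simpa using h⟩
    have hpos : ∃ i, 0 < w i := by
      by_contra! h
      exact hw0 (neg_eq_zero.1 (hker (-w) (fun i => by simpa using h i) (by simpa using hwT)
        (by simp [Matrix.mulVec_neg, hAw])))
    obtain ⟨t, ht, hnn, hss⟩ := exists_sub_smul_nonneg hv hwT hpos
    refine le_trans ?_ (ih _ (hc ▸ Set.ncard_lt_ncard hss) hnn
      (by simpa [Matrix.mulVec_sub, Matrix.mulVec_smul, hAw] using hAv)
      (fun u h0 hu => hker u h0 (hu.trans hss.subset)) rfl)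
    simpa using mul_nonpos_of_nonneg_of_nonpos ht hwj

/-- A nonnegative vector dominating no nonzero nonnegative integer kernel vector of `A` has
entries bounded in terms of its image and the entries of `A`. -/
theorem le_of_no_int_kernel_le {A : Matrix m n ℤ} {Δ β : ℝ} (hΔ : 1 ≤ Δ)
    (hm : 0 < Fintype.card m) (hA : ∀ i j, |(A i j : ℝ)| ≤ Δ) (hβ : 0 ≤ β) {v : n → ℝ}
    (hv : 0 ≤ v) (hAv : ∀ i, |(A.map (Int.cast : ℤ → ℝ)).mulVec v i| ≤ β)
    (hker : ∀ z : n → ℤ, 0 ≤ z → (∀ i, (z i : ℝ) ≤ v i) → A.mulVec z = 0 → z = 0) (j : n) :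
    v j ≤ (β + (Function.support v).ncard) *
      (Δ ^ Fintype.card m * Real.sqrt (Fintype.card m) ^ Fintype.card m) := by
  set H := Δ ^ Fintype.card m * Real.sqrt (Fintype.card m) ^ Fintype.card m
  have hH0 : 0 ≤ H := by positivity
  induction hc : (Function.support v).ncard using Nat.strong_induction_on generalizing v with
  | _ c ih =>
  by_cases hT : ∀ u : n → ℝ, 0 ≤ u → Function.support u ⊆ Function.support v →
      (A.map (Int.cast : ℤ → ℝ)).mulVec u = 0 → u = 0
  · refine (le_of_no_nonneg_kernel hΔ hA hβ hv hAv hT j).trans ?_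
    exact mul_le_mul_of_nonneg_right (le_add_of_nonneg_right (Nat.cast_nonneg _)) hH0
  · push Not at hT
    obtain ⟨u, hu, huv, hAu, hu0⟩ := hT
    obtain ⟨z, hz0, hz, hAz, hzu, hzle⟩ := exists_int_circuit hΔ hm hA hu hu0 hAu
    let w : n → ℝ := fun i => z i
    have hw : 0 ≤ w := fun i => Int.cast_nonneg (hz i)
    have hAw : (A.map (Int.cast : ℤ → ℝ)).mulVec w = 0 := by
      ext i
      have h : ((A.mulVec z i : ℤ) : ℝ) = 0 := by rw [hAz]; simp
      simpa [Matrix.mulVec, dotProduct] using h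
    have hwv : Function.support w ⊆ Function.support v := fun i hi =>
      huv (hzu (by simpa [w] using hi))
    obtain ⟨i, hi⟩ := Function.ne_iff.1 hz0
    obtain ⟨t, ht, hnn, hss⟩ := exists_sub_smul_nonneg hv hwv
      ⟨i, lt_of_le_of_ne (hw i) (by simpa [w, eq_comm] using hi)⟩
    have ht1 : t ≤ 1 := by
      by_contra! h
      refine hz0 (hker z hz (fun i => ?_) hAz)
      have h1 : t * w i ≤ v i := by simpa using hnn i
      exact (le_mul_of_one_le_left (hw i) h.le).trans h1
    have hlt := Set.ncard_lt_ncard hss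
    have hbd := ih _ (hc ▸ hlt) hnn
      (by simpa [Matrix.mulVec_sub, Matrix.mulVec_smul, hAw] using hAv)
      (fun y hy hyv => hker y hy fun i => (hyv i).trans
        (by simpa using mul_nonneg ht (hw i))) rfl
    have hvj : v j = (v - t • w) j + t * w j := by simp
    have htw : t * w j ≤ H := (mul_le_of_le_one_left (hw j) ht1).trans (hzle j)
    have hcount : ((Function.support (v - t • w)).ncard : ℝ) + 1 ≤ c := by
      exact_mod_cast hc ▸ hlt
    calc v j ≤ (β + (Function.support (v - t • w)).ncard) * H + H := by
          rw [hvj]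
          exact add_le_add hbd htw
      _ = (β + ((Function.support (v - t • w)).ncard + 1)) * H := by ring
      _ ≤ (β + c) * H := by gcongr

/-- An integer vector with no nonzero conformal integer kernel vector of `A` below it has entries
bounded in terms of its image and the entries of `A`. -/
theorem abs_le_of_no_conformal_kernel {A : Matrix m n ℤ} {Δ β : ℝ} (hΔ : 1 ≤ Δ)
    (hm : 0 < Fintype.card m) (hA : ∀ i j, |(A i j : ℝ)| ≤ Δ) (hβ : 0 ≤ β) {d : n → ℤ}
    (hAd : ∀ i, |(A.mulVec d i : ℝ)| ≤ β)
    (hker : ∀ z : n → ℤ, (∀ i, 0 ≤ z i * d i) → (∀ i, |z i| ≤ |d i|) → A.mulVec z = 0 → z = 0)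
    (j : n) :
    |(d j : ℝ)| ≤ (β + Fintype.card n) *
      (Δ ^ Fintype.card m * Real.sqrt (Fintype.card m) ^ Fintype.card m) := by
  let σ : n → ℤ := fun i => if 0 ≤ d i then 1 else -1
  have hσ (i : n) : |σ i| = 1 := by
    simp only [σ]
    split_ifs <;> simp
  have hσd (i : n) : σ i * |d i| = d i := by
    simp only [σ]
    split_ifs with h
    · rw [one_mul, abs_of_nonneg h]
    · rw [abs_of_neg (not_le.1 h)]
      ring
  let A' : Matrix m n ℤ := Matrix.of fun i k => A i k * σ k
  have hmul (z : n → ℤ) : A'.mulVec z = A.mulVec fun k => σ k * z k := by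
    ext i
    simp [A', Matrix.mulVec, dotProduct, mul_assoc]
  have hA' (i : m) (k : n) : |(A' i k : ℝ)| ≤ Δ := by
    have : |((σ k : ℤ) : ℝ)| = 1 := by exact_mod_cast hσ k
    simpa [A', abs_mul, this] using hA i k
  have h := le_of_no_int_kernel_le hΔ hm hA' hβ (v := fun i => (|d i| : ℤ))
    (fun i => by simp) (fun i => ?_) (fun z hz hzd hAz => ?_) j
  · refine (by simpa using h : |(d j : ℝ)| ≤ _).trans ?_
    gcongr
    exact_mod_cast (Set.ncard_le_card _).trans_eq Nat.card_eq_fintype_card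
  · have h1 : (A'.map (Int.cast : ℤ → ℝ)).mulVec (fun i => ((|d i| : ℤ) : ℝ)) i =
        (A'.mulVec (fun i => |d i|) i : ℤ) := by
      simp [Matrix.mulVec, dotProduct]
    rw [h1, hmul]
    simpa only [hσd] using hAd i
  · have hz0 := hker (fun k => σ k * z k) (fun i => ?_) (fun i => ?_) (by rw [← hmul, hAz])
    · ext i
      have h1 : |σ i * z i| = 0 := by simpa using congrFun hz0 i
      rw [abs_mul, hσ, one_mul] at h1
      exact abs_eq_zero.1 h1
    · have : σ i * σ i = 1 := by rw [← abs_mul_abs_self, hσ, one_mul]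
      calc 0 ≤ z i * |d i| := mul_nonneg (hz i) (abs_nonneg _)
        _ = (σ i * σ i) * (z i * |d i|) := by rw [this, one_mul]
        _ = σ i * z i * (σ i * |d i|) := by ring
        _ = σ i * z i * d i := by rw [hσd]
    · rw [abs_mul, hσ, one_mul, abs_of_nonneg (hz i)]
      exact_mod_cast hzd i

end Sensitivity

/-- `IntSol A b c` is the set of optimal solutions of the ILP
`min cᵀx  s.t.  A x = b, x ∈ ℤ^N, x ≥ 0`. -/
def IntSol {M N : ℕ} (A : Matrix (Fin M) (Fin N) ℤ) (b : Fin M → ℤ) (c : Fin N → ℤ) :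
    Set (Fin N → ℤ) :=
  {x | (∀ j, 0 ≤ x j) ∧ A.mulVec x = b ∧
    ∀ y : Fin N → ℤ, (∀ j, 0 ≤ y j) → A.mulVec y = b →
      (∑ j, c j * x j) ≤ ∑ j, c j * y j}

/-- Sensitivity of integer programs under change of the right-hand side: if both
`IntSol A b c` and `IntSol A b' c` are non-empty, then for every `x ∈ IntSol A b c` there is
`y ∈ IntSol A b' c` with `‖x - y‖_∞ ≤ (‖b - b'‖_∞ + 2) * N * Δ^M * M^(M/2)`, where `Δ` is the
maximum absolute value of an entry of `A` and `M^(M/2) = (√M)^M`. -/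
theorem ilp_sensitivity (M N : ℕ) (hM : 0 < M) (hN : 0 < N)
    (A : Matrix (Fin M) (Fin N) ℤ) (b b' : Fin M → ℤ) (c : Fin N → ℤ)
    (x : Fin N → ℤ) (hx : x ∈ IntSol A b c) (hne : (IntSol A b' c).Nonempty) :
    ∃ y ∈ IntSol A b' c,
      ((Finset.univ.sup fun j : Fin N => (x j - y j).natAbs : ℕ) : ℝ) ≤
        (((Finset.univ.sup fun i : Fin M => (b i - b' i).natAbs : ℕ) : ℝ) + 2) * (N : ℝ) *
          ((Finset.univ.sup (fun q : Fin M × Fin N => (A q.1 q.2).natAbs) : ℕ) : ℝ) ^ M *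
          (Real.sqrt M) ^ M := by
  obtain ⟨y, hy, hmin⟩ := (measure fun y : Fin N → ℤ => ∑ j, (x j - y j).natAbs).wf.has_min
    (IntSol A b' c) hne
  obtain ⟨hx0, hAx, hxopt⟩ := hx
  have ⟨hy0, hAy, hyopt⟩ := hy
  have hker (z : Fin N → ℤ) (hzd : ∀ i, 0 ≤ z i * (x i - y i))
      (hzle : ∀ i, |z i| ≤ |x i - y i|) (hAz : A.mulVec z = 0) : z = 0 := by
    have hbetween (i : Fin N) : (0 ≤ z i ∧ z i ≤ x i - y i) ∨ (x i - y i ≤ z i ∧ z i ≤ 0) := by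
      have h1 := hzd i
      have h2 := hzle i
      rcases lt_trichotomy (x i - y i) 0 with h | h | h
      · have h3 : z i ≤ 0 := nonpos_of_mul_nonneg_left h1 h
        rw [abs_of_nonpos h3, abs_of_neg h] at h2
        omega
      · rw [h, abs_zero, abs_nonpos_iff] at h2
        omega
      · have h3 : 0 ≤ z i := nonneg_of_mul_nonneg_left h1 h
        rw [abs_of_nonneg h3, abs_of_pos h] at h2
        omega
    have hxz := hxopt (x - z)
      (fun i => by have := hx0 i; have := hy0 i; have := hbetween i; simp only [Pi.sub_apply]; omega)
      (by rw [Matrix.mulVec_sub, hAx, hAz, sub_zero])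
    have hyz0 (i : Fin N) : 0 ≤ (y + z) i := by
      have := hx0 i
      have := hy0 i
      have := hbetween i
      simp only [Pi.add_apply]
      omega
    have hyz : y + z ∈ IntSol A b' c := by
      refine ⟨hyz0, by rw [Matrix.mulVec_add, hAy, hAz, add_zero], fun w hw hAw => ?_⟩
      refine le_trans ?_ (hyopt w hw hAw)
      simp only [Pi.sub_apply, Pi.add_apply, mul_sub, mul_add, Finset.sum_sub_distrib,
        Finset.sum_add_distrib] at hxz ⊢
      linarith
    by_contra hz
    obtain ⟨i, hi⟩ := Function.ne_iff.1 hz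
    have hlt : ∑ j, (x j - (y + z) j).natAbs < ∑ j, (x j - y j).natAbs → False := hmin _ hyz
    refine hlt (Finset.sum_lt_sum (fun j _ => ?_) ⟨i, Finset.mem_univ i, ?_⟩)
    · have := hbetween j
      simp only [Pi.add_apply]
      omega
    · have := hbetween i
      simp only [Pi.add_apply, Pi.zero_apply] at hi ⊢
      omega
  refine ⟨y, hy, ?_⟩
  have : Nonempty (Fin N) := ⟨⟨0, hN⟩⟩
  obtain ⟨j, -, hj⟩ := Finset.exists_mem_eq_sup Finset.univ Finset.univ_nonempty
    fun j : Fin N => (x j - y j).natAbs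
  rw [hj]
  set β : ℕ := Finset.univ.sup fun i : Fin M => (b i - b' i).natAbs
  set Δ : ℕ := Finset.univ.sup fun q : Fin M × Fin N => (A q.1 q.2).natAbs
  have hA (i : Fin M) (k : Fin N) : (A i k).natAbs ≤ Δ :=
    Finset.le_sup (f := fun q : Fin M × Fin N => (A q.1 q.2).natAbs) (Finset.mem_univ (i, k))
  have hd (i : Fin M) : |(A.mulVec (x - y) i : ℝ)| ≤ β := by
    rw [Matrix.mulVec_sub, hAx, hAy, ← Int.cast_abs, Int.abs_eq_natAbs, Int.cast_natCast]
    exact_mod_cast Finset.le_sup (f := fun i : Fin M => (b i - b' i).natAbs) (Finset.mem_univ i)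
  rcases Nat.eq_zero_or_pos Δ with h0 | hpos
  · have hA0 : A = 0 := by
      ext i k
      simpa [h0] using hA i k
    have hxy := congrFun (hker (x - y) (fun i => mul_self_nonneg _) (fun i => le_rfl)
      (by rw [hA0, Matrix.zero_mulVec])) j
    rw [show (x j - y j).natAbs = 0 by simpa using hxy, Nat.cast_zero]
    positivity
  · have hbound := abs_le_of_no_conformal_kernel (A := A) (Δ := Δ) (β := β) (d := x - y)
      (by exact_mod_cast hpos) (by simpa using hM)
      (fun i k => by
        rw [← Int.cast_abs, Int.abs_eq_natAbs, Int.cast_natCast]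
        exact_mod_cast hA i k)
      (Nat.cast_nonneg _) hd hker j
    rw [Fintype.card_fin, Fintype.card_fin, ← Int.cast_abs, Int.abs_eq_natAbs,
      Int.cast_natCast] at hbound
    refine hbound.trans ?_
    rw [mul_assoc (((β : ℝ) + 2) * N)]
    refine mul_le_mul_of_nonneg_right ?_ (by positivity)
    have hN1 : (1 : ℝ) ≤ N := by exact_mod_cast hN
    nlinarith [mul_nonneg (Nat.cast_nonneg (α := ℝ) β) (sub_nonneg.2 hN1)]
end
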